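/- arXiv:1505.04292 — 9 statements merged into one kernel-verified Lean document; each statement's English description precedes it below -/
import Mathlib

section
/- Let n >= 2 and let Y = (Y_{1,n}, ..., Y_{n-1,n}) be a centered jointly Gaussian random vector with covariances d^{Y,n}_{jk} = E[Y_{j,n} Y_{k,n}]. Assume there is a real number eps_n >= 0 with |(1/(n-1)) * sum_{k=1}^{n-1} d^{Y,n}_{kk} - 1| <= eps_n, and set nu_n = max_{1 <= k <= n-1} sum_{j=1}^{n-1} |d^{Y,n}_{kj}|. Then for all z > 0: P( (1/sqrt(n-1)) * sum_{k=1}^{n-1} (Y_{k,n}^2 - d^{Y,n}_{kk}) >= z ) <= varphi_{r,n}(z; nu_n, eps_n) and P( (1/sqrt(n-1)) * sum_{k=1}^{n-1} (Y_{k,n}^2 - d^{Y,n}_{kk}) <= -z ) <= varphi_{l,n}(z; nu_n, eps_n), where varphi_{r,n}(z; nu, eps) := exp(-z*sqrt(n-1)/(2*nu)) * (1 + z/((eps+1)*sqrt(n-1)))^{(eps+1)*(n-1)/(2*nu)} and varphi_{l,n}(z; nu, eps) := exp(z*sqrt(n-1)/(2*nu)) * (1 - z/((eps+1)*sqrt(n-1)))^{(eps+1)*(n-1)/(2*nu)}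 * 1_{[0, (eps+1)*sqrt(n-1)]}(z). -/
open MeasureTheory ProbabilityTheory

section
open Real
open scoped NNReal

/-- `x ↦ exp (s x ^ 2)` is integrable under a centered Gaussian of variance `v` when `2 s v < 1`. -/
lemma integrable_exp_mul_sq_gaussianReal {v : ℝ≥0} {s : ℝ} (hs : 2 * s * v < 1) :
    Integrable (fun x : ℝ => exp (s * x ^ 2)) (gaussianReal 0 v) := by
  rcases eq_or_ne v 0 with rfl | hv
  · simp [gaussianReal_zero_var, integrable_dirac]
  have hv' : (0 : ℝ) < v := by positivity
  rw [gaussianReal_of_var_ne_zero _ hv]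
  rw [integrable_withDensity_iff_integrable_smul' (measurable_gaussianPDF _ _)
    (Filter.Eventually.of_forall fun x => gaussianPDF_lt_top)]
  simp only [toReal_gaussianPDF, smul_eq_mul, gaussianPDFReal, sub_zero]
  have hb : 0 < (2 * v : ℝ)⁻¹ - s := by
    rw [sub_pos, ← one_div, lt_div_iff₀ (by positivity)]
    linarith
  refine ((integrable_exp_neg_mul_sq hb).const_mul (√(2 * π * v))⁻¹).congr ?_
  refine Filter.Eventually.of_forall fun x => ?_
  simp only [mul_assoc, ← exp_add]
  congr 2
  field_simp
  ring

/-- The moment generating function of the square of a centered Gaussian variable. -/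
lemma integral_exp_mul_sq_gaussianReal {v : ℝ≥0} {s : ℝ} (hs : 2 * s * v < 1) :
    ∫ x : ℝ, exp (s * x ^ 2) ∂gaussianReal 0 v = exp (-(log (1 - 2 * s * v) / 2)) := by
  rcases eq_or_ne v 0 with rfl | hv
  · simp [gaussianReal_zero_var]
  have hv' : (0 : ℝ) < v := by positivity
  have hpos : 0 < 1 - 2 * s * v := by linarith
  have key : ∀ x : ℝ, gaussianPDFReal 0 v x • exp (s * x ^ 2) =
      (√(2 * π * v))⁻¹ * exp (-((1 - 2 * s * v) / (2 * v)) * x ^ 2) := by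
    intro x
    simp only [gaussianPDFReal, smul_eq_mul, mul_assoc, ← exp_add]
    congr 2
    field_simp
    ring
  rw [integral_gaussianReal_eq_integral_smul hv]
  simp_rw [key]
  rw [integral_const_mul, integral_gaussian, exp_neg, exp_half, exp_log hpos,
    ← sqrt_inv, ← sqrt_inv, ← sqrt_mul (by positivity)]
  congr 1
  field_simp

/-- Concavity of the logarithm along the segment from `1` to `1 - x * ν`. -/
lemma mul_log_one_sub_mul_le {a ν x : ℝ} (ha : 0 ≤ a) (haν : a ≤ ν) (hν : 0 < ν)
    (hx : x * ν < 1) : a / ν * log (1 - x * ν) ≤ log (1 - x * a) := by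
  have haν' : 0 ≤ 1 - a / ν := sub_nonneg.2 (div_le_one_of_le₀ haν hν.le)
  have h := strictConcaveOn_log_Ioi.concaveOn.2 (Set.mem_Ioi.2 one_pos)
    (Set.mem_Ioi.2 (sub_pos.2 hx)) haν' (div_nonneg ha hν.le) (sub_add_cancel _ _)
  have e : (1 - a / ν) + a / ν * (1 - x * ν) = 1 - x * a := by field_simp; ring
  simpa [e] using h

/-- A jointly Gaussian centered family is an orthogonal transform of an independent centered
Gaussian family, whose variances are bounded by the row sums of the covariance matrix. -/
lemma exists_iIndepFun_gaussian_sum_sq_eq {Ω ι : Type*} [MeasurableSpace Ω] [Fintype ι]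
    {P : Measure Ω} [IsProbabilityMeasure P] {Y : ι → Ω → ℝ} (hmeas : ∀ i, Measurable (Y i))
    (hGauss : ∀ c : ι → ℝ, ∃ v : ℝ≥0, P.map (fun ω => ∑ i, c i * Y i ω) = gaussianReal 0 v)
    {d : ι → ι → ℝ} (hd : ∀ j k, d j k = ∫ ω, Y j ω * Y k ω ∂P) :
    ∃ (Z : ι → Ω → ℝ) (v : ι → ℝ≥0), iIndepFun Z P ∧ (∀ i, Measurable (Z i)) ∧
      (∀ i, P.map (Z i) = gaussianReal 0 (v i)) ∧ (∀ ω, ∑ i, Z i ω ^ 2 = ∑ i, Y i ω ^ 2) ∧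
      (∑ i, (v i : ℝ) = ∑ i, d i i) ∧ ∀ i, ∃ k, (v i : ℝ) ≤ ∑ j, |d k j| := by
  classical
  have hmem (c : ι → ℝ) : MemLp (fun ω => ∑ i, c i * Y i ω) 2 P := by
    obtain ⟨v, hv⟩ := hGauss c
    have h := memLp_id_gaussianReal (μ := 0) (v := v) 2
    rw [← hv] at h
    exact h.comp_of_map (by fun_prop)
  have hmean (c : ι → ℝ) : ∫ ω, ∑ i, c i * Y i ω ∂P = 0 := by
    obtain ⟨v, hv⟩ := hGauss c
    have h := integral_id_gaussianReal (μ := 0) (v := v)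
    rwa [← hv, integral_map (by fun_prop) (by fun_prop)] at h
  have hYmem (i : ι) : MemLp (Y i) 2 P := by
    simpa [Pi.single_apply] using hmem (Pi.single i 1)
  have hG : HasGaussianLaw (fun ω i => Y i ω) P := by
    refine ⟨isGaussian_of_map_eq_gaussianReal fun L => ?_⟩
    obtain ⟨v, hv⟩ := hGauss fun i => L (Pi.single i 1)
    refine ⟨0, v, ?_⟩
    rw [Measure.map_map (by fun_prop) (by fun_prop), ← hv]
    congr 1
    ext ω
    simp only [Function.comp_apply]
    conv_lhs => rw [← Finset.univ_sum_single (fun i => Y i ω), map_sum]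
    refine Finset.sum_congr rfl fun i _ => ?_
    rw [mul_comm, ← smul_eq_mul, ← map_smul, ← Pi.single_smul, smul_eq_mul, mul_one]
  have H : (Matrix.of d).IsHermitian := by
    ext i j
    simp only [Matrix.conjTranspose_apply, Matrix.of_apply, star_trivial, hd, mul_comm]
  set b := H.eigenvectorBasis
  set Z : ι → Ω → ℝ := fun i ω => ∑ j, b i j * Y j ω with hZ
  have hZG : HasGaussianLaw (fun ω i => Z i ω) P := by
    have := hG.map (Matrix.toLin' (Matrix.of fun i j => b i j)).toContinuousLinearMap
    convert! this using 1
  have hZmeas (i : ι) : Measurable (Z i) := by fun_prop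
  have hprod (i j : ι) : ∫ ω, Z i ω * Z j ω ∂P = if i = j then H.eigenvalues j else 0 := by
    have e : ∀ ω, Z i ω * Z j ω = ∑ k, ∑ l, b i k * b j l * (Y k ω * Y l ω) := fun ω => by
      simp only [hZ, Finset.sum_mul_sum]
      exact Finset.sum_congr rfl fun k _ => Finset.sum_congr rfl fun l _ => by ring
    have hint (k l : ι) : Integrable (fun ω => b i k * b j l * (Y k ω * Y l ω)) P :=
      ((hYmem k).integrable_mul (hYmem l)).const_mul _
    simp_rw [e]
    rw [integral_finsetSum _ fun k _ => integrable_finsetSum _ fun l _ => hint k l]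
    simp_rw [integral_finsetSum _ fun l _ => hint _ l, integral_const_mul, ← hd]
    have h1 (k : ι) : ∑ l, d k l * b j l = H.eigenvalues j * b j k :=
      congrFun (H.mulVec_eigenvectorBasis j) k
    have h2 := b.inner_eq_ite j i
    rw [PiLp.inner_apply] at h2
    calc ∑ k, ∑ l, b i k * b j l * d k l = ∑ k, b i k * ∑ l, d k l * b j l := by
          simp only [Finset.mul_sum]
          exact Finset.sum_congr rfl fun k _ => Finset.sum_congr rfl fun l _ => by ring
      _ = H.eigenvalues j * ∑ k, inner ℝ (b j k) (b i k) := by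
          simp only [h1, Finset.mul_sum]
          exact Finset.sum_congr rfl fun k _ => by simp; ring
      _ = _ := by rw [h2]; simp [eq_comm]
  have hindep : iIndepFun Z P := hZG.iIndepFun_of_covariance_eq_zero fun i j hij => by
    rw [covariance_eq_sub (hmem _) (hmem _), hmean, zero_mul, sub_zero]
    exact (hprod i j).trans (if_neg hij)
  choose v hv using fun i => hGauss fun j => b i j
  have hvar (i : ι) : (v i : ℝ) = H.eigenvalues i := by
    have h := variance_id_gaussianReal (μ := 0) (v := v i)
    rw [← hv i, variance_id_map (by fun_prop), variance_of_integral_eq_zero (by fun_prop)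
      (hmean _)] at h
    rw [← h]
    simpa [sq] using hprod i i
  refine ⟨Z, v, hindep, hZmeas, hv, fun ω => ?_, ?_, fun i => ?_⟩
  · have h := b.sum_sq_norm_inner_right (WithLp.toLp 2 fun i => Y i ω)
    simpa [EuclideanSpace.norm_sq_eq, PiLp.inner_apply, hZ, mul_comm] using h
  · simpa [hvar, Matrix.trace] using H.trace_eq_sum_eigenvalues.symm
  · have hev : Module.End.HasEigenvalue (Matrix.toLin' (Matrix.of d)) (H.eigenvalues i) := by
      rw [Module.End.hasEigenvalue_iff_mem_spectrum, Matrix.spectrum_toLin']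
      exact H.eigenvalues_mem_spectrum_real i
    obtain ⟨k, hk⟩ := eigenvalue_mem_ball hev
    refine ⟨k, ?_⟩
    rw [Metric.mem_closedBall, Real.dist_eq] at hk
    rw [hvar, ← Finset.add_sum_erase _ _ (Finset.mem_univ k)]
    have h1 := le_abs_self (H.eigenvalues i - d k k)
    have h2 := le_abs_self (d k k)
    simp only [Matrix.of_apply, Real.norm_eq_abs] at hk
    linarith

/-- The sum of squares of independent centered Gaussian variables has exponential moments of
order `s` when `2 s v < 1` for all the variances `v`. -/
lemma integrable_exp_mul_sum_sq {Ω ι : Type*} [MeasurableSpace Ω] [Fintype ι]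
    {P : Measure Ω} [IsProbabilityMeasure P] {Z : ι → Ω → ℝ} {v : ι → ℝ≥0} (hZ : iIndepFun Z P)
    (hmeas : ∀ i, Measurable (Z i)) (hlaw : ∀ i, P.map (Z i) = gaussianReal 0 (v i)) {s : ℝ}
    (hs : ∀ i, 2 * s * v i < 1) : Integrable (fun ω => exp (s * ∑ i, Z i ω ^ 2)) P := by
  have hind : iIndepFun (fun i ω => Z i ω ^ 2) P :=
    hZ.comp (fun _ x => x ^ 2) fun _ => by fun_prop
  have h := hind.integrable_exp_mul_sum (t := s) (s := Finset.univ) (fun i => by fun_prop)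
    fun i _ => by
      have h := integrable_exp_mul_sq_gaussianReal (hs i)
      rw [← hlaw i] at h
      exact h.comp_measurable (hmeas i)
  simpa using h

/-- The moment generating function of a sum of squares of independent centered Gaussians. -/
lemma mgf_sum_sq {Ω ι : Type*} [MeasurableSpace Ω] [Fintype ι]
    {P : Measure Ω} [IsProbabilityMeasure P] {Z : ι → Ω → ℝ} {v : ι → ℝ≥0} (hZ : iIndepFun Z P)
    (hmeas : ∀ i, Measurable (Z i)) (hlaw : ∀ i, P.map (Z i) = gaussianReal 0 (v i)) {s : ℝ}
    (hs : ∀ i, 2 * s * v i < 1) :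
    mgf (fun ω => ∑ i, Z i ω ^ 2) P s = exp (∑ i, -(log (1 - 2 * s * v i) / 2)) := by
  have hind : iIndepFun (fun i ω => Z i ω ^ 2) P :=
    hZ.comp (fun _ x => x ^ 2) fun _ => by fun_prop
  have h := hind.mgf_sum (t := s) (fun i => by fun_prop) Finset.univ
  have e : (∑ i, fun ω => Z i ω ^ 2) = fun ω => ∑ i, Z i ω ^ 2 := by ext; simp
  rw [e] at h
  rw [h, exp_sum]
  refine Finset.prod_congr rfl fun i _ => ?_
  rw [← integral_exp_mul_sq_gaussianReal (hs i), ← hlaw i, integral_map (by fun_prop)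
    (by fun_prop), mgf]

/-- The optimized Chernoff exponent for a sum of squares of independent centered Gaussians with
variances at most `ν` and total variance at most `M`, at signed deviation `t > -M`. -/
lemma exp_mul_exp_sum_log_le {ι : Type*} [Fintype ι] {v : ι → ℝ≥0} {ν M t : ℝ} (hν : 0 < ν)
    (hM : 0 < M) (hvν : ∀ i, v i ≤ ν) (hvM : ∑ i, (v i : ℝ) ≤ M) (ht : 0 < M + t) :
    exp (-(t / (2 * ν * (M + t))) * (∑ i, (v i : ℝ) + t)) *
        exp (∑ i, -(log (1 - 2 * (t / (2 * ν * (M + t))) * v i) / 2)) ≤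
      exp (-t / (2 * ν)) * (1 + t / M) ^ (M / (2 * ν)) := by
  set s := t / (2 * ν * (M + t)) with hs
  have hsν : 1 - 2 * s * ν = M / (M + t) := by rw [hs]; field_simp; ring
  have hpos : 0 < M / (M + t) := by positivity
  have hinv : 1 + t / M = (M / (M + t))⁻¹ := by field_simp
  have hsum : ∑ i, -(log (1 - 2 * s * v i) / 2) ≤
      (∑ i, (v i : ℝ)) * (-(log (1 - 2 * s * ν) / (2 * ν))) := by
    rw [Finset.sum_mul]
    refine Finset.sum_le_sum fun i _ => ?_
    have h := mul_log_one_sub_mul_le (v i).2 (hvν i) hν (x := 2 * s) (by linarith)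
    have e : (v i : ℝ) * -(log (1 - 2 * s * ν) / (2 * ν)) =
      -(v i / ν * log (1 - 2 * s * ν)) / 2 := by field_simp
    rw [e]
    simp only [NNReal.val_eq_coe] at h
    linarith
  have hnonneg : 0 ≤ -(log (1 - 2 * s * ν) / (2 * ν)) - s := by
    have h := log_le_sub_one_of_pos (hsν ▸ hpos)
    have e : -(log (1 - 2 * s * ν) / (2 * ν)) - s =
      (1 - 2 * s * ν - 1 - log (1 - 2 * s * ν)) / (2 * ν) := by field_simp; ring
    rw [e]
    exact div_nonneg (by linarith) (by positivity)
  have hmul := mul_le_mul_of_nonneg_right hvM hnonneg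
  rw [← exp_add, rpow_def_of_pos (by rw [hinv]; positivity), ← exp_add, hinv, log_inv, ← hsν]
  refine exp_le_exp.2 ?_
  have e : -t / (2 * ν) + -log (1 - 2 * s * ν) * (M / (2 * ν)) =
      M * (-(log (1 - 2 * s * ν) / (2 * ν)) - s) - s * t := by
    have : t / (2 * ν) = s * (M + t) := by rw [hs]; field_simp
    rw [neg_div, this]
    ring
  rw [e]
  linarith

/-- Upper and lower tail bounds for the sum of squares of a centered Gaussian vector. -/
lemma measure_sum_sq_tails_le {Ω ι : Type*} [MeasurableSpace Ω] [Fintype ι]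
    {P : Measure Ω} [IsProbabilityMeasure P] {Y : ι → Ω → ℝ} (hmeas : ∀ i, Measurable (Y i))
    (hGauss : ∀ c : ι → ℝ, ∃ v : ℝ≥0, P.map (fun ω => ∑ i, c i * Y i ω) = gaussianReal 0 v)
    {d : ι → ι → ℝ} (hd : ∀ j k, d j k = ∫ ω, Y j ω * Y k ω ∂P) {M ν t : ℝ} (hM : 0 < M)
    (hdM : ∑ k, d k k ≤ M) (hν : IsGreatest (Set.range fun k => ∑ j, |d k j|) ν) (ht : 0 < t) :
    P {ω | ∑ k, d k k + t ≤ ∑ k, Y k ω ^ 2} ≤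
        ENNReal.ofReal (exp (-t / (2 * ν)) * (1 + t / M) ^ (M / (2 * ν))) ∧
      P {ω | ∑ k, Y k ω ^ 2 ≤ ∑ k, d k k + -t} ≤
        ENNReal.ofReal (exp (t / (2 * ν)) * (1 - t / M) ^ (M / (2 * ν)) *
          if t ≤ M then 1 else 0) := by
  obtain ⟨Z, v, hindep, hZmeas, hlaw, hsq, hsum, hrow⟩ :=
    exists_iIndepFun_gaussian_sum_sq_eq hmeas hGauss hd
  have hvν (i : ι) : (v i : ℝ) ≤ ν := by
    obtain ⟨k, hk⟩ := hrow i
    exact hk.trans (hν.2 ⟨k, rfl⟩)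
  have hν0 : 0 ≤ ν := by
    obtain ⟨k, rfl⟩ := hν.1
    positivity
  simp only [← hsq, ← hsum]
  rw [← hsum] at hdM
  have two_mul_lt {u : ℝ} (hu : 0 < M + u) (hν : 0 < ν) :
      ∀ i, 2 * (u / (2 * ν * (M + u))) * v i < 1 := fun i => by
    have : 2 * (u / (2 * ν * (M + u))) * v i = u / (M + u) * (v i / ν) := by field_simp
    rw [this]
    have h1 : u / (M + u) < 1 := by rw [div_lt_one hu]; linarith
    have h2 : (v i / ν : ℝ) ≤ 1 := div_le_one_of_le₀ (hvν i) hν0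
    have h3 : (0 : ℝ) ≤ v i / ν := by positivity
    rcases h3.eq_or_lt with h3 | h3
    · simp [← h3]
    · exact (mul_lt_of_lt_one_left h3 h1).trans_le h2
  rcases hν0.eq_or_lt with rfl | hνpos
  · refine ⟨by simpa using prob_le_one, ?_⟩
    have hv (i : ι) : (v i : ℝ) = 0 := le_antisymm (hvν i) (v i).2
    have : {ω | ∑ i, Z i ω ^ 2 ≤ ∑ i, (v i : ℝ) + -t} = ∅ := by
      ext ω
      have : 0 ≤ ∑ i, Z i ω ^ 2 := by positivity
      simp only [hv, Finset.sum_const_zero, Set.mem_ofPred_eq, Set.mem_empty_iff_false, iff_false]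
      linarith
    rw [this]
    simp
  refine ⟨?_, ?_⟩
  · have hs := two_mul_lt (u := t) (by linarith) hνpos
    refine (ENNReal.le_ofReal_iff_toReal_le (measure_ne_top _ _) (by positivity)).2 ?_
    refine (measure_ge_le_exp_mul_mgf (X := fun ω => ∑ i, Z i ω ^ 2) _ (by positivity)
      (integrable_exp_mul_sum_sq hindep hZmeas hlaw hs)).trans ?_
    rw [mgf_sum_sq hindep hZmeas hlaw hs]
    exact exp_mul_exp_sum_log_le hνpos hM hvν hdM (by linarith)
  · have hlt {u : ℝ} (hu0 : 0 ≤ u) (hu : u < M) :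
        P.real {ω | ∑ i, Z i ω ^ 2 ≤ ∑ i, (v i : ℝ) + -u} ≤
          exp (u / (2 * ν)) * (1 - u / M) ^ (M / (2 * ν)) := by
      have hs := two_mul_lt (u := -u) (by linarith) hνpos
      refine (measure_le_le_exp_mul_mgf (X := fun ω => ∑ i, Z i ω ^ 2) _
        (div_nonpos_of_nonpos_of_nonneg (by linarith) ?_)
        (integrable_exp_mul_sum_sq hindep hZmeas hlaw hs)).trans ?_
      · exact mul_nonneg (by positivity) (by linarith)
      rw [mgf_sum_sq hindep hZmeas hlaw hs]
      have h := exp_mul_exp_sum_log_le hνpos hM hvν hdM (t := -u) (by linarith)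
      rwa [neg_neg, neg_div M u, ← sub_eq_add_neg] at h
    have hle (htM : t ≤ M) : P.real {ω | ∑ i, Z i ω ^ 2 ≤ ∑ i, (v i : ℝ) + -t} ≤
        exp (t / (2 * ν)) * (1 - t / M) ^ (M / (2 * ν)) := by
      have hcont : ContinuousAt
          (fun u : ℝ => exp (u / (2 * ν)) * (1 - u / M) ^ (M / (2 * ν))) t :=
        ContinuousAt.mul (by fun_prop)
          (ContinuousAt.rpow_const (by fun_prop) (Or.inr (by positivity)))
      refine ge_of_tendsto (hcont.tendsto.mono_left (nhdsWithin_le_nhds (s := Set.Iio t))) ?_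
      filter_upwards [Ioo_mem_nhdsLT ht] with u hu
      refine (measureReal_mono fun ω (hω : ∑ i, Z i ω ^ 2 ≤ _) => ?_).trans
        (hlt hu.1.le (hu.2.trans_le htM))
      exact hω.trans (by linarith [hu.2])
    split_ifs with htM
    · rw [mul_one]
      exact (ENNReal.le_ofReal_iff_toReal_le (measure_ne_top _ _)
        (measureReal_nonneg.trans (hle htM))).2 (hle htM)
    · have : {ω | ∑ i, Z i ω ^ 2 ≤ ∑ i, (v i : ℝ) + -t} = ∅ := by
        ext ω
        have : 0 ≤ ∑ i, Z i ω ^ 2 := by positivity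
        simp only [Set.mem_ofPred_eq, Set.mem_empty_iff_false, iff_false]
        linarith
      rw [this]
      simp

end

/-- Concentration inequality for the second-order quadratic variation vector
`Y = (Y_{1,n}, …, Y_{n-1,n})` (Proposition `main`). -/
theorem stmt_2
    {Ω : Type*} [MeasurableSpace Ω] (P : Measure Ω) [IsProbabilityMeasure P]
    (n : ℕ) (hn : 2 ≤ n)
    (Y : Fin (n - 1) → Ω → ℝ)
    (hmeas : ∀ i, Measurable (Y i))
    (hGauss : ∀ c : Fin (n - 1) → ℝ, ∃ v : NNReal,
      P.map (fun ω => ∑ i, c i * Y i ω) = gaussianReal 0 v)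
    (d : Fin (n - 1) → Fin (n - 1) → ℝ)
    (hd : ∀ j k, d j k = ∫ ω, Y j ω * Y k ω ∂P)
    (εn : ℝ) (hεn : 0 ≤ εn)
    (hεbound : |(1 / ((n : ℝ) - 1)) * ∑ k, d k k - 1| ≤ εn)
    (νn : ℝ)
    (hν : IsGreatest (Set.range fun k => ∑ j, |d k j|) νn) :
    ∀ z > 0,
      P {ω | z ≤ (1 / Real.sqrt ((n : ℝ) - 1)) * ∑ k, ((Y k ω) ^ 2 - d k k)} ≤
        ENNReal.ofReal
          (Real.exp (-(z * Real.sqrt ((n : ℝ) - 1)) / (2 * νn)) *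
            (1 + z / ((εn + 1) * Real.sqrt ((n : ℝ) - 1))) ^
              ((εn + 1) * ((n : ℝ) - 1) / (2 * νn))) ∧
      P {ω | (1 / Real.sqrt ((n : ℝ) - 1)) * ∑ k, ((Y k ω) ^ 2 - d k k) ≤ -z} ≤
        ENNReal.ofReal
          (Real.exp (z * Real.sqrt ((n : ℝ) - 1) / (2 * νn)) *
            (1 - z / ((εn + 1) * Real.sqrt ((n : ℝ) - 1))) ^
              ((εn + 1) * ((n : ℝ) - 1) / (2 * νn)) *
            Set.indicator (Set.Icc 0 ((εn + 1) * Real.sqrt ((n : ℝ) - 1)))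
              (fun _ => (1 : ℝ)) z) := by
  have hN : (0 : ℝ) < (n : ℝ) - 1 := by
    have : (2 : ℝ) ≤ n := by exact_mod_cast hn
    linarith
  set N := (n : ℝ) - 1
  have hsq : Real.sqrt N * Real.sqrt N = N := Real.mul_self_sqrt hN.le
  have hsN : 0 < Real.sqrt N := Real.sqrt_pos.2 hN
  intro z hz
  set M := (εn + 1) * N with hMdef
  set t := z * Real.sqrt N with ht
  have hM : 0 < M := by positivity
  have htpos : 0 < t := by positivity
  have hdM : ∑ k, d k k ≤ M := by
    have h := (abs_le.1 hεbound).2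
    rw [one_div, sub_le_iff_le_add, inv_mul_le_iff₀ hN] at h
    linarith
  have hdiv : z / ((εn + 1) * Real.sqrt N) = t / M := by
    rw [ht, hMdef]
    nth_rewrite 3 [← hsq]
    field_simp
  have hmem : z ∈ Set.Icc 0 ((εn + 1) * Real.sqrt N) ↔ t ≤ M := by
    rw [Set.mem_Icc, and_iff_right hz.le, ht, hMdef, ← mul_le_mul_iff_left₀ hsN, mul_assoc, hsq]
  have hset (ω : Ω) : (1 / Real.sqrt N) * ∑ k, ((Y k ω) ^ 2 - d k k) =
      (∑ k, Y k ω ^ 2 - ∑ k, d k k) / Real.sqrt N := by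
    rw [Finset.sum_sub_distrib]; ring
  have hright (ω : Ω) : z ≤ (1 / Real.sqrt N) * ∑ k, ((Y k ω) ^ 2 - d k k) ↔
      ∑ k, d k k + t ≤ ∑ k, Y k ω ^ 2 := by
    rw [hset, le_div_iff₀ hsN, le_sub_iff_add_le, add_comm]
  have hleft (ω : Ω) : (1 / Real.sqrt N) * ∑ k, ((Y k ω) ^ 2 - d k k) ≤ -z ↔
      ∑ k, Y k ω ^ 2 ≤ ∑ k, d k k + -t := by
    rw [hset, div_le_iff₀ hsN, sub_le_iff_le_add, ht, neg_mul, add_comm]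
  simp only [hright, hleft, hdiv]
  have hind : Set.indicator (Set.Icc 0 ((εn + 1) * Real.sqrt N)) (fun _ => (1 : ℝ)) z =
      if t ≤ M then 1 else 0 := by
    simp only [Set.indicator_apply, hmem]
  rw [hind]
  exact measure_sum_sq_tails_le hmeas hGauss hd hM hdM hν htpos
end

section
/- Let H in (0,1) with H != 1/2, let T > 0 and let n >= 2 be an integer. For integers k >= 1 define b(k,H) := 2^{2H-1}(k+1)^{2H} + 3 * 2^{2H} k^{2H} + 2^{2H-1}(k-1)^{2H} - 2(2k+1)^{2H} - 2(2k-1)^{2H} and d^{S^H}_{kk} := 1 - b(k,H)/(4 - 2^{2H}). Then |(1/(n-1)) * sum_{k=1}^{n-1} d^{S^H}_{kk} - 1| <= (T/n)^{2/3} * ( (1/(6T)) * n/(n-1) + 33/(9 * ln 4) ). -/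
lemma hasDerivAt_fwdDiff_iterate {a : ℝ} {f f' : ℝ → ℝ}
    (hd : ∀ y, a < y → HasDerivAt f (f' y) y) (k : ℕ) :
    ∀ y, a < y → HasDerivAt ((fwdDiff 1)^[k] f) ((fwdDiff 1)^[k] f' y) y := by
  induction k with
  | zero => simpa using hd
  | succ k ih =>
    intro y hy
    rw [Function.iterate_succ_apply', Function.iterate_succ_apply']
    exact ((ih (y + 1) (by linarith)).comp_add_const y 1).sub (ih y hy)

lemma continuousOn_fwdDiff_iterate {a : ℝ} {f : ℝ → ℝ} (hf : ContinuousOn f (Set.Ici a)) (k : ℕ) :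
    ContinuousOn ((fwdDiff 1)^[k] f) (Set.Ici a) := by
  induction k with
  | zero => simpa using hf
  | succ k ih =>
    rw [Function.iterate_succ_apply']
    refine (ih.comp (f := fun y : ℝ => y + 1) (by fun_prop) ?_).sub ih
    intro y hy
    simp only [Set.mem_Ici] at hy ⊢
    linarith

lemma fwdDiff_iterate_succ_nonneg {a : ℝ} {f f' : ℝ → ℝ} (hf : ContinuousOn f (Set.Ici a))
    (hd : ∀ y, a < y → HasDerivAt f (f' y) y) {k : ℕ}
    (h : ∀ y, a < y → 0 ≤ (fwdDiff 1)^[k] f' y) : 0 ≤ (fwdDiff 1)^[k + 1] f a := by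
  have hD := hasDerivAt_fwdDiff_iterate hd k
  have hmono : MonotoneOn ((fwdDiff 1)^[k] f) (Set.Ici a) := by
    refine monotoneOn_of_deriv_nonneg (convex_Ici a) (continuousOn_fwdDiff_iterate hf k) ?_ ?_
    · intro y hy
      rw [interior_Ici] at hy
      exact (hD y hy).differentiableAt.differentiableWithinAt
    · intro y hy
      rw [interior_Ici] at hy
      rw [(hD y hy).deriv]
      exact h y hy
  rw [Function.iterate_succ_apply']
  exact sub_nonneg.2 (hmono (Set.mem_Ici.2 le_rfl) (Set.mem_Ici.2 (by linarith)) (by linarith))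

/-- The `k`-th forward difference of `y ↦ y ^ p` has the sign of `p (p - 1) ⋯ (p - k + 1)`. -/
lemma prod_mul_fwdDiff_iterate_rpow_nonneg (k : ℕ) :
    ∀ p y : ℝ, 0 < y ∨ (0 ≤ y ∧ 0 < p) →
      0 ≤ (∏ i ∈ Finset.range k, (p - i)) * (fwdDiff 1)^[k] (fun z : ℝ => z ^ p) y := by
  induction k with
  | zero =>
    intro p y hy
    have : 0 ≤ y := by rcases hy with h | h <;> linarith
    simpa using Real.rpow_nonneg this p
  | succ k ih =>
    intro p a ha
    have ha0 : 0 ≤ a := by rcases ha with h | h <;> linarith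
    set c := ∏ i ∈ Finset.range (k + 1), (p - i) with hc
    have hcp : c = p * ∏ i ∈ Finset.range k, (p - 1 - i) := by
      rw [hc, Finset.prod_range_succ', mul_comm]
      simp [sub_sub, add_comm]
    rw [← smul_eq_mul, ← Pi.smul_apply, ← fwdDiff_iter_const_smul]
    refine fwdDiff_iterate_succ_nonneg (f' := (c * p) • fun z : ℝ => z ^ (p - 1)) ?_ ?_ ?_
    · refine ContinuousOn.const_smul (fun y hy => ?_) c
      refine (Real.continuousAt_rpow_const y p ?_).continuousWithinAt
      rcases ha with h | h
      · exact Or.inl (lt_of_lt_of_le h hy).ne'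
      · exact Or.inr h.2.le
    · intro y hy
      have := (Real.hasDerivAt_rpow_const (x := y) (p := p)
        (Or.inl (by linarith [hy, ha0]))).const_mul c
      rw [← mul_assoc] at this
      exact this
    · intro y hy
      rw [fwdDiff_iter_const_smul, Pi.smul_apply, smul_eq_mul, hcp]
      have := mul_nonneg (sq_nonneg p) (ih (p - 1) y (Or.inl (by linarith)))
      linarith

lemma sum_alternate_fwdDiff_mem_Icc {g : ℕ → ℝ} (hg : Antitone g) (h0 : ∀ j, 0 ≤ g j) (m : ℕ) :
    ∑ i ∈ Finset.range m, (g (2 * i) - g (2 * i + 1)) ∈ Set.Icc 0 (g 0) := by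
  have hle : ∑ i ∈ Finset.range m, (g (2 * i) - g (2 * i + 1)) ≤ g 0 - g (2 * m) := by
    induction m with
    | zero => simp
    | succ m ih =>
      rw [Finset.sum_range_succ]
      have := hg (show 2 * m + 1 ≤ 2 * (m + 1) by omega)
      linarith
  exact ⟨Finset.sum_nonneg fun i _ => sub_nonneg.2 (hg (Nat.le_succ _)),
    hle.trans (by linarith [h0 (2 * m)])⟩

lemma abs_sum_alternate_fwdDiff_rpow_le {x : ℝ} (hx0 : 0 < x) (hx2 : x < 2) (hx1 : x ≠ 1) (m : ℕ) :
    |∑ i ∈ Finset.range m, (fwdDiff 1)^[4] (fun z : ℝ => z ^ x) ((2 * i : ℕ) : ℝ)| ≤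
      |(fwdDiff 1)^[3] (fun z : ℝ => z ^ x) 0| := by
  set g : ℕ → ℝ := fun j => (fwdDiff 1)^[3] (fun z : ℝ => z ^ x) (j : ℝ) with hg
  have h4 (j : ℕ) : (fwdDiff 1)^[4] (fun z : ℝ => z ^ x) (j : ℝ) = g (j + 1) - g j := by
    rw [Function.iterate_succ_apply', hg]
    simp [fwdDiff]
  have s3 (j : ℕ) := prod_mul_fwdDiff_iterate_rpow_nonneg 3 x j (Or.inr ⟨by positivity, hx0⟩)
  have s4 (j : ℕ) := prod_mul_fwdDiff_iterate_rpow_nonneg 4 x j (Or.inr ⟨by positivity, hx0⟩)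
  have hg0 : (fwdDiff 1)^[3] (fun z : ℝ => z ^ x) 0 = g 0 := by simp [hg]
  rw [hg0]
  simp only [h4] at s4 ⊢
  simp only [Finset.prod_range_succ, Finset.prod_range_zero] at s3 s4
  push_cast at s3 s4
  rcases lt_or_gt_of_ne hx1 with h | h
  · have hP : 0 < x * (1 - x) * (2 - x) := by
      have := sub_pos.2 h; have := sub_pos.2 hx2; positivity
    have hQ : 0 < x * (1 - x) * (2 - x) * (3 - x) := mul_pos hP (by linarith)
    obtain ⟨h1, h2⟩ := sum_alternate_fwdDiff_mem_Icc (g := g)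
      (antitone_nat_of_succ_le fun j => by
        have := s4 j
        exact sub_nonneg.1 (nonneg_of_mul_nonneg_right (by linarith) hQ))
      (fun j => nonneg_of_mul_nonneg_right (by linarith [s3 j]) hP) m
    rw [← abs_neg, ← Finset.sum_neg_distrib]
    simp only [neg_sub]
    rw [abs_of_nonneg h1]
    exact h2.trans (le_abs_self _)
  · have hP : 0 < x * (x - 1) * (2 - x) := by
      have := sub_pos.2 h; have := sub_pos.2 hx2; positivity
    have hQ : 0 < x * (x - 1) * (2 - x) * (3 - x) := mul_pos hP (by linarith)
    obtain ⟨h1, h2⟩ := sum_alternate_fwdDiff_mem_Icc (g := fun j => -g j)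
      (antitone_nat_of_succ_le fun j => by
        have := s4 j
        have : 0 ≤ g (j + 1) - g j := nonneg_of_mul_nonneg_right (by linarith) hQ
        linarith)
      (fun j => nonneg_of_mul_nonneg_right (by linarith [s3 j]) hP) m
    simp only [neg_sub_neg] at h1 h2
    rw [abs_of_nonneg h1]
    exact h2.trans (neg_le_abs _)

lemma abs_third_fwdDiff_rpow_zero_le {x : ℝ} (hx0 : 0 < x) (hx2 : x < 2) :
    |(fwdDiff 1)^[3] (fun z : ℝ => z ^ x) 0| ≤ 3 / 2 * (4 - 2 ^ x) := by
  have h : (fwdDiff 1)^[3] (fun z : ℝ => z ^ x) 0 = 3 ^ x - 3 * 2 ^ x + 3 := by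
    simp only [Function.iterate_succ_apply', Function.iterate_zero, id, fwdDiff]
    norm_num [Real.zero_rpow hx0.ne']
    ring
  rw [h]
  have e2 : (2 : ℝ) ^ (x - 2) = 2 ^ x / 4 := by
    rw [Real.rpow_sub (by norm_num)]; norm_num
  have e3 : (3 : ℝ) ^ (x - 2) = 3 ^ x / 9 := by
    rw [Real.rpow_sub (by norm_num)]; norm_num
  have e4 : (4 : ℝ) ^ (x - 2) = (2 ^ x / 4) ^ 2 := by
    rw [← e2, pow_two, ← Real.mul_rpow (by norm_num) (by norm_num)]; norm_num
  have h23 : (3 : ℝ) ^ (x - 2) ≤ 2 ^ (x - 2) :=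
    Real.rpow_le_rpow_of_nonpos (by norm_num) (by norm_num) (by linarith)
  have h34 : (4 : ℝ) ^ (x - 2) ≤ 3 ^ (x - 2) :=
    Real.rpow_le_rpow_of_nonpos (by norm_num) (by norm_num) (by linarith)
  have hlt : (2 : ℝ) ^ (x - 2) ≤ 1 :=
    Real.rpow_le_one_of_one_le_of_nonpos (by norm_num) (by linarith)
  rw [e2] at h23 hlt
  rw [e3] at h23 h34
  rw [e4] at h34
  rw [abs_le]
  constructor
  · nlinarith [sq_nonneg ((2 : ℝ) ^ x / 4 - 1)]
  · linarith

lemma three_quarters_le_mul_rpow_mul {T n : ℝ} (hT : 0 < T) (hn : 2 ≤ n) :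
    3 / 4 / (n - 1) ≤ (T / n) ^ ((2 : ℝ) / 3) *
      ((1 / (6 * T)) * (n / (n - 1)) + 33 / (9 * Real.log 4)) := by
  have hn0 : 0 < n := by linarith
  have hm : 0 < n - 1 := by linarith
  set v : ℝ := (T / n) ^ ((1 : ℝ) / 3) with hv
  have hu : 0 < T / n := by positivity
  have hvpos : 0 < v := Real.rpow_pos_of_pos hu _
  have hv2 : (T / n) ^ ((2 : ℝ) / 3) = v ^ 2 := by
    rw [hv, ← Real.rpow_natCast, ← Real.rpow_mul hu.le]; norm_num
  have hv3 : T = n * v ^ 3 := by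
    rw [hv, ← Real.rpow_natCast, ← Real.rpow_mul hu.le]; norm_num
    field_simp
  have hC : 5 / 2 ≤ 33 / (9 * Real.log 4) := by
    have h4 : Real.log 4 = 2 * Real.log 2 := by
      rw [show (4 : ℝ) = 2 ^ 2 by norm_num, Real.log_pow]; norm_num
    have := Real.log_two_lt_d9
    have := Real.log_pos (show (1 : ℝ) < 2 by norm_num)
    rw [h4, le_div_iff₀ (by positivity)]
    linarith
  have key : 3 / 4 ≤ 1 / (6 * v) + 5 / 2 * v ^ 2 := by
    have : 1 / (6 * v) + 5 / 2 * v ^ 2 - 3 / 4 = (2 + 30 * v ^ 3 - 9 * v) / (12 * v) := by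
      field_simp; ring
    have h2 : 0 ≤ 2 + 30 * v ^ 3 - 9 * v := by
      nlinarith [mul_nonneg hvpos.le (sq_nonneg (v - 316 / 1000)), sq_nonneg (v - 316 / 1000)]
    have : 0 ≤ (2 + 30 * v ^ 3 - 9 * v) / (12 * v) := by positivity
    linarith
  have hfirst : v ^ 2 * ((1 / (6 * T)) * (n / (n - 1))) = 1 / (6 * v) / (n - 1) := by
    rw [hv3]; field_simp
  have hsecond : 5 / 2 * v ^ 2 / (n - 1) ≤ v ^ 2 * (33 / (9 * Real.log 4)) := by
    calc 5 / 2 * v ^ 2 / (n - 1) ≤ 5 / 2 * v ^ 2 := div_le_self (by positivity) (by linarith)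
      _ ≤ v ^ 2 * (33 / (9 * Real.log 4)) := by nlinarith [sq_nonneg v]
  rw [hv2, mul_add, hfirst]
  calc 3 / 4 / (n - 1) ≤ (1 / (6 * v) + 5 / 2 * v ^ 2) / (n - 1) := by gcongr
    _ = 1 / (6 * v) / (n - 1) + 5 / 2 * v ^ 2 / (n - 1) := add_div _ _ _
    _ ≤ _ := by gcongr


/-- Bound on the deviation of the mean normalized diagonal covariances of the
second-order increments of sub-fractional Brownian motion. -/
theorem stmt_7 (H : ℝ) (hH : H ∈ Set.Ioo (0 : ℝ) 1) (hH2 : H ≠ 1 / 2)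
    (T : ℝ) (hT : 0 < T) (n : ℕ) (hn : 2 ≤ n)
    (b : ℕ → ℝ)
    (hb : ∀ k, 1 ≤ k → b k =
      2 ^ (2 * H - 1) * ((k : ℝ) + 1) ^ (2 * H) + 3 * 2 ^ (2 * H) * (k : ℝ) ^ (2 * H)
      + 2 ^ (2 * H - 1) * ((k : ℝ) - 1) ^ (2 * H)
      - 2 * (2 * (k : ℝ) + 1) ^ (2 * H) - 2 * (2 * (k : ℝ) - 1) ^ (2 * H))
    (d : ℕ → ℝ) (hd : ∀ k, 1 ≤ k → d k = 1 - b k / (4 - 2 ^ (2 * H))) :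
    |(1 / ((n : ℝ) - 1)) * ∑ k ∈ Finset.Icc 1 (n - 1), d k - 1|
      ≤ (T / n) ^ ((2 : ℝ) / 3) *
        ((1 / (6 * T)) * ((n : ℝ) / ((n : ℝ) - 1)) + 33 / (9 * Real.log 4)) := by
  set x := 2 * H with hx
  obtain ⟨hH0, hH1⟩ := hH
  have hx0 : 0 < x := by linarith
  have hx2 : x < 2 := by linarith
  have hx1 : x ≠ 1 := fun h => hH2 (by linarith)
  obtain ⟨m, rfl⟩ : ∃ m, n = m + 1 := ⟨n - 1, by omega⟩
  have hm : (0 : ℝ) < m := by exact_mod_cast (by omega : 0 < m)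
  have hden : 0 < 4 - (2 : ℝ) ^ x := by
    have := Real.rpow_lt_rpow_of_exponent_lt (x := 2) (by norm_num) hx2
    norm_num at this
    linarith
  have hb' (i : ℕ) : b (i + 1) =
      1 / 2 * (fwdDiff 1)^[4] (fun z : ℝ => z ^ x) ((2 * i : ℕ) : ℝ) := by
    have hi : (0 : ℝ) ≤ i := Nat.cast_nonneg i
    rw [hb (i + 1) (by omega), Real.rpow_sub_one (by norm_num)]
    simp only [Function.iterate_succ_apply', Function.iterate_zero, id, fwdDiff]
    push_cast
    have e0 : (2 * (i : ℝ)) ^ x = 2 ^ x * (i : ℝ) ^ x := Real.mul_rpow (by norm_num) hi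
    have e1 : (2 * (i : ℝ) + 1 + 1) ^ x = 2 ^ x * ((i : ℝ) + 1) ^ x := by
      rw [← Real.mul_rpow (by norm_num) (by positivity)]; ring_nf
    have e2 : (2 * (i : ℝ) + 1 + 1 + 1 + 1) ^ x = 2 ^ x * ((i : ℝ) + 1 + 1) ^ x := by
      rw [← Real.mul_rpow (by norm_num) (by positivity)]; ring_nf
    rw [e0, e1, e2, show 2 * ((i : ℝ) + 1) + 1 = 2 * i + 1 + 1 + 1 by ring,
      show 2 * ((i : ℝ) + 1) - 1 = 2 * i + 1 by ring, add_sub_cancel_right]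
    ring
  have hsum : ∑ k ∈ Finset.Icc 1 m, d k = m - (∑ i ∈ Finset.range m,
      (fwdDiff 1)^[4] (fun z : ℝ => z ^ x) ((2 * i : ℕ) : ℝ)) / 2 / (4 - 2 ^ x) := by
    have hIcc : Finset.Icc 1 m = Finset.Ico 1 (m + 1) := by ext; simp
    rw [hIcc, Finset.sum_Ico_eq_sum_range, Nat.add_sub_cancel]
    have (i : ℕ) : d (1 + i) =
        1 - (fwdDiff 1)^[4] (fun z : ℝ => z ^ x) ((2 * i : ℕ) : ℝ) / 2 / (4 - 2 ^ x) := by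
      rw [add_comm, hd _ (by omega), hb']; ring
    simp only [this, Finset.sum_sub_distrib, Finset.sum_div]
    simp
  have hS := (abs_sum_alternate_fwdDiff_rpow_le hx0 hx2 hx1 m).trans
    (abs_third_fwdDiff_rpow_zero_le hx0 hx2)
  refine le_trans ?_ (three_quarters_le_mul_rpow_mul hT (by exact_mod_cast hn))
  rw [Nat.add_sub_cancel, hsum]
  set S := ∑ i ∈ Finset.range m, (fwdDiff 1)^[4] (fun z : ℝ => z ^ x) ((2 * i : ℕ) : ℝ)
  push_cast
  rw [add_sub_cancel_right]
  have hrw : 1 / (m : ℝ) * (m - S / 2 / (4 - 2 ^ x)) - 1 = -(S / (2 * (4 - 2 ^ x)) / m) := by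
    field_simp
    ring
  rw [hrw, abs_neg, abs_div, abs_of_pos hm, abs_div,
    abs_of_pos (show 0 < 2 * (4 - (2 : ℝ) ^ x) by positivity)]
  refine div_le_div_of_nonneg_right ?_ hm.le
  rw [div_le_iff₀ (by positivity)]
  linarith
end

section
/- Let H in (0,1) with H != 1/2 and let k >= 2 be an integer. With b(k,H) := 2^{2H-1}(k+1)^{2H} + 3 * 2^{2H} k^{2H} + 2^{2H-1}(k-1)^{2H} - 2(2k+1)^{2H} - 2(2k-1)^{2H}, the bound |b(k,H)| / (4 - 2^{2H}) <= (33/(9 * ln 4)) * k^{-2} holds. -/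
theorem exists_second_difference_eq {F F' F'' : ℝ → ℝ} {x : ℝ}
    (h1 : ∀ y ∈ Set.Icc (x - 1) (x + 1), HasDerivAt F (F' y) y)
    (h2 : ∀ y ∈ Set.Icc (x - 1) (x + 1), HasDerivAt F' (F'' y) y) :
    ∃ ξ ∈ Set.Ioo (x - 1) (x + 1), F (x + 1) - 2 * F x + F (x - 1) = F'' ξ := by
  have hd : ∀ y ∈ Set.Icc (x - 1) x,
      HasDerivAt (fun t => F (t + 1) - F t) (F' (y + 1) - F' y) y := by
    intro y hy
    exact ((h1 (y + 1) ⟨by linarith [hy.1], by linarith [hy.2]⟩).comp_add_const y 1).sub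
      (h1 y ⟨hy.1, by linarith [hy.2]⟩)
  obtain ⟨c, hc, hce⟩ := exists_hasDerivAt_eq_slope (fun t => F (t + 1) - F t)
    (fun y => F' (y + 1) - F' y) (by linarith : x - 1 < x)
    (fun y hy => (hd y hy).continuousAt.continuousWithinAt)
    (fun y hy => hd y (Set.Ioo_subset_Icc_self hy))
  have hsub : ∀ y ∈ Set.Icc c (c + 1), y ∈ Set.Icc (x - 1) (x + 1) := fun y hy =>
    ⟨by linarith [hy.1, hc.1], by linarith [hy.2, hc.2]⟩
  obtain ⟨ξ, hξ, hξe⟩ := exists_hasDerivAt_eq_slope F' F'' (by linarith : c < c + 1)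
    (fun y hy => (h2 y (hsub y hy)).continuousAt.continuousWithinAt)
    (fun y hy => h2 y (hsub y (Set.Ioo_subset_Icc_self hy)))
  refine ⟨ξ, ⟨by linarith [hξ.1, hc.1], by linarith [hξ.2, hc.2]⟩, ?_⟩
  rw [hξe, add_sub_cancel_left, div_one, hce, sub_sub_cancel, div_one, sub_add_cancel]
  ring

theorem hasDerivAt_const_mul_rpow (c p : ℝ) {y : ℝ} (hy : 0 < y) :
    HasDerivAt (fun t : ℝ => c * t ^ p) (c * p * y ^ (p - 1)) y := by
  have h := (Real.hasDerivAt_rpow_const (p := p) (Or.inl hy.ne')).const_mul c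
  rwa [← mul_assoc] at h

theorem hasDerivAt_second_difference {F F' : ℝ → ℝ}
    (h : ∀ y : ℝ, 0 < y → HasDerivAt F (F' y) y) {y : ℝ} (hy : 1 < y) :
    HasDerivAt (fun t => F (t + 1) - 2 * F t + F (t - 1))
      (F' (y + 1) - 2 * F' y + F' (y - 1)) y :=
  (((h (y + 1) (by linarith)).comp_add_const y 1).sub
    ((h y (by linarith)).const_mul 2)).add ((h (y - 1) (by linarith)).comp_sub_const y 1)

theorem exists_fourth_difference_rpow_eq (a : ℝ) {m : ℝ} (hm : 2 < m) :
    ∃ η ∈ Set.Ioo (m - 2) (m + 2),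
      (m + 2) ^ a - 4 * (m + 1) ^ a + 6 * m ^ a - 4 * (m - 1) ^ a + (m - 2) ^ a
        = a * (a - 1) * (a - 2) * (a - 3) * η ^ (a - 4) := by
  have d0 : ∀ y : ℝ, 0 < y → HasDerivAt (fun t : ℝ => t ^ a) (a * y ^ (a - 1)) y := fun y hy =>
    Real.hasDerivAt_rpow_const (Or.inl hy.ne')
  have d1 : ∀ y : ℝ, 0 < y → HasDerivAt (fun t : ℝ => a * t ^ (a - 1))
      (a * (a - 1) * y ^ (a - 2)) y := fun y hy => by
    convert hasDerivAt_const_mul_rpow a (a - 1) hy using 3; ring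
  have d2 : ∀ y : ℝ, 0 < y → HasDerivAt (fun t : ℝ => a * (a - 1) * t ^ (a - 2))
      (a * (a - 1) * (a - 2) * y ^ (a - 3)) y := fun y hy => by
    convert hasDerivAt_const_mul_rpow (a * (a - 1)) (a - 2) hy using 3; ring
  have d3 : ∀ y : ℝ, 0 < y → HasDerivAt (fun t : ℝ => a * (a - 1) * (a - 2) * t ^ (a - 3))
      (a * (a - 1) * (a - 2) * (a - 3) * y ^ (a - 4)) y := fun y hy => by
    convert hasDerivAt_const_mul_rpow (a * (a - 1) * (a - 2)) (a - 3) hy using 3; ring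
  obtain ⟨ξ, hξ, hξe⟩ := exists_second_difference_eq (x := m)
    (fun y hy => hasDerivAt_second_difference d0 (by linarith [hy.1]))
    (fun y hy => hasDerivAt_second_difference d1 (by linarith [hy.1]))
  obtain ⟨η, hη, hηe⟩ := exists_second_difference_eq (x := ξ)
    (fun y hy => d2 y (by linarith [hy.1, hξ.1]))
    (fun y hy => d3 y (by linarith [hy.1, hξ.1]))
  refine ⟨η, ⟨by linarith [hη.1, hξ.1], by linarith [hη.2, hξ.2]⟩, ?_⟩
  rw [← hηe, ← hξe, add_sub_cancel_right, sub_add_cancel,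
    show m + 1 + 1 = m + 2 by ring, show m - 1 - 1 = m - 2 by ring]
  ring

/-- Pointwise bound `|b(k,H)|/(4 - 2^{2H}) ≤ (33/(9 ln 4)) k^{-2}` for `k ≥ 2`. -/
theorem stmt_8 (H : ℝ) (hH : H ∈ Set.Ioo (0 : ℝ) 1) (hH2 : H ≠ 1 / 2)
    (k : ℕ) (hk : 2 ≤ k) :
    |2 ^ (2 * H - 1) * ((k : ℝ) + 1) ^ (2 * H) + 3 * 2 ^ (2 * H) * (k : ℝ) ^ (2 * H)
      + 2 ^ (2 * H - 1) * ((k : ℝ) - 1) ^ (2 * H)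
      - 2 * (2 * (k : ℝ) + 1) ^ (2 * H) - 2 * (2 * (k : ℝ) - 1) ^ (2 * H)|
      / (4 - 2 ^ (2 * H))
    ≤ (33 / (9 * Real.log 4)) * ((k : ℝ) ^ 2)⁻¹ := by
  obtain ⟨h0, h1⟩ := hH
  have hk' : (2 : ℝ) ≤ k := by exact_mod_cast hk
  obtain ⟨η, hη, hηe⟩ := exists_fourth_difference_rpow_eq (2 * H)
    (by linarith : (2 : ℝ) < 2 * k)
  have hb : 2 ^ (2 * H - 1) * ((k : ℝ) + 1) ^ (2 * H) + 3 * 2 ^ (2 * H) * (k : ℝ) ^ (2 * H)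
      + 2 ^ (2 * H - 1) * ((k : ℝ) - 1) ^ (2 * H)
      - 2 * (2 * (k : ℝ) + 1) ^ (2 * H) - 2 * (2 * (k : ℝ) - 1) ^ (2 * H)
      = 2 * H * (2 * H - 1) * (1 - H) * (3 - 2 * H) * η ^ (2 * H - 4) := by
    rw [show 2 * (k : ℝ) + 2 = 2 * (k + 1) by ring, show 2 * (k : ℝ) - 2 = 2 * (k - 1) by ring,
      Real.mul_rpow (by norm_num) (by linarith), Real.mul_rpow (by norm_num) (by linarith),
      Real.mul_rpow (by norm_num) (by linarith)] at hηe
    rw [Real.rpow_sub_one (by norm_num)]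
    linear_combination hηe / 2
  have hkη : (k : ℝ) ≤ η := by linarith [hη.1]
  have hpow : η ^ (2 * H - 4) ≤ ((k : ℝ) ^ 2)⁻¹ := by
    calc η ^ (2 * H - 4) ≤ η ^ (-2 : ℝ) :=
          Real.rpow_le_rpow_of_exponent_le (by linarith) (by linarith)
      _ = (η ^ 2)⁻¹ := by rw [Real.rpow_neg (by linarith), Real.rpow_two]
      _ ≤ ((k : ℝ) ^ 2)⁻¹ := by gcongr
  have hden : 3 * (1 - H) ≤ 4 - (2 : ℝ) ^ (2 * H) := by
    have h := rpow_one_add_le_one_add_mul_self (s := 3) (by norm_num) h0.le h1.le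
    rw [Real.rpow_mul (by norm_num), Real.rpow_two]
    norm_num at h ⊢
    linarith
  have hlog0 : 0 < Real.log 4 := Real.log_pos (by norm_num)
  have hlog : 1 ≤ 33 / (9 * Real.log 4) := by
    have h4 : Real.log 4 = 2 * Real.log 2 := by
      rw [show (4 : ℝ) = 2 ^ 2 by norm_num, Real.log_pow]; norm_num
    rw [le_div_iff₀ (by positivity), h4]
    linarith [Real.log_two_lt_d9]
  have hcoef : 2 * H * |2 * H - 1| * (3 - 2 * H) ≤ 3 := by
    have habs : |2 * H - 1| ≤ 1 := abs_le.2 ⟨by linarith, by linarith⟩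
    have hq : 0 ≤ 2 * H * (3 - 2 * H) := mul_nonneg (by linarith) (by linarith)
    nlinarith [mul_le_mul_of_nonneg_left habs hq, sq_nonneg (4 * H - 3)]
  have hη0 : 0 ≤ η ^ (2 * H - 4) := Real.rpow_nonneg (by linarith) _
  rw [hb, div_le_iff₀ (by linarith), abs_mul, abs_mul, abs_mul, abs_mul, abs_of_nonneg hη0,
    abs_of_pos (by linarith : 0 < 2 * H), abs_of_pos (by linarith : 0 < 1 - H),
    abs_of_pos (by linarith : 0 < 3 - 2 * H)]
  calc 2 * H * |2 * H - 1| * (1 - H) * (3 - 2 * H) * η ^ (2 * H - 4)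
      = 2 * H * |2 * H - 1| * (3 - 2 * H) * (1 - H) * η ^ (2 * H - 4) := by ring
    _ ≤ 3 * (1 - H) * ((k : ℝ) ^ 2)⁻¹ := by
        have : 0 ≤ 1 - H := by linarith
        gcongr
    _ ≤ (4 - 2 ^ (2 * H)) * ((k : ℝ) ^ 2)⁻¹ := by gcongr
    _ = 1 * ((k : ℝ) ^ 2)⁻¹ * (4 - 2 ^ (2 * H)) := by ring
    _ ≤ 33 / (9 * Real.log 4) * ((k : ℝ) ^ 2)⁻¹ * (4 - 2 ^ (2 * H)) := by
        have : 0 ≤ 4 - (2 : ℝ) ^ (2 * H) := by linarith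
        gcongr
end

section
/- Let H in (0,1) with H != 1/2, T > 0, n >= 2 an integer, grid t_i = i*T/n, and G_H(s,t) := s^{2H} + t^{2H} - (1/2)[(s+t)^{2H} + |s-t|^{2H}]. For 1 <= j, k <= n-1 define \hat d^{S^H,n}_{jk} := sum_{a=-1}^{1} sum_{b=-1}^{1} w_a w_b G_H(t_{j+a}, t_{k+b}) (weights w_{-1} = w_1 = 1, w_0 = -2) and d^{S^H,n}_{jk} := (n^{2H} / (T^{2H} (4 - 2^{2H}))) * \hat d^{S^H,n}_{jk}. Then max_{1 <= k <= n-1} sum_{j=1}^{n-1} |d^{S^H,n}_{jk}| <= 9/2. -/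
open Finset

theorem hasDerivAt_fwdDiff_iter {f f' : ℝ → ℝ} (hf : ∀ x > 0, HasDerivAt f (f' x) x) (k : ℕ) :
    ∀ x > 0, HasDerivAt ((fwdDiff (1 : ℝ))^[k] f) ((fwdDiff (1 : ℝ))^[k] f' x) x := by
  induction k with
  | zero => exact hf
  | succ k ih =>
    intro x hx
    simp only [Function.iterate_succ_apply']
    exact ((ih (x + 1) (by linarith)).comp_add_const x 1).sub (ih x hx)

/-- Mean value theorem for iterated unit differences of a power function. -/
theorem exists_fwdDiff_iter_rpow_eq (k : ℕ) : ∀ (q x : ℝ), 0 < x →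
    ∃ c > 0, (fwdDiff (1 : ℝ))^[k] (fun y : ℝ => y ^ q) x = (∏ i ∈ range k, (q - i)) * c ^ (q - k) := by
  induction k with
  | zero => exact fun q x hx => ⟨x, hx, by simp⟩
  | succ k ih =>
    intro q x hx
    have hd := hasDerivAt_fwdDiff_iter (f := fun y : ℝ => y ^ q)
      (f' := q • fun y : ℝ => y ^ (q - 1))
      (fun y hy => Real.hasDerivAt_rpow_const (Or.inl hy.ne')) k
    obtain ⟨c, hc, hcx⟩ := exists_hasDerivAt_eq_slope _ _ (lt_add_one x)
      (fun y hy => (hd y (hx.trans_le hy.1)).continuousAt.continuousWithinAt)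
      (fun y hy => hd y (hx.trans hy.1))
    obtain ⟨e, he, hce⟩ := ih (q - 1) c (hx.trans hc.1)
    refine ⟨e, he, ?_⟩
    rw [fwdDiff_iter_const_smul, Pi.smul_apply, hce] at hcx
    rw [Function.iterate_succ_apply', fwdDiff, prod_range_succ']
    have h1 : (fwdDiff (1 : ℝ))^[k] (fun y : ℝ => y ^ q) (x + 1) - (fwdDiff (1 : ℝ))^[k] (fun y : ℝ => y ^ q) x
        = q • ((∏ i ∈ range k, (q - 1 - (i : ℝ))) * e ^ (q - 1 - k)) := by
      rw [hcx]; simp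
    rw [h1, smul_eq_mul]
    push_cast
    simp only [sub_zero, sub_sub, add_comm (1 : ℝ)]
    ring

theorem fwdDiff_iter_rpow_sign {p : ℝ} (hp : 0 ≤ p) (k : ℕ) {s : ℝ}
    (hs : 0 ≤ s * ∏ i ∈ range k, (p - i)) :
    ∀ x ≥ 0, 0 ≤ s * (fwdDiff (1 : ℝ))^[k] (fun y : ℝ => y ^ p) x := by
  have hcont : ∀ k : ℕ, Continuous ((fwdDiff (1 : ℝ))^[k] (fun y : ℝ => y ^ p)) := by
    intro k
    induction k with
    | zero => exact Real.continuous_rpow_const hp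
    | succ k ih =>
      simp only [Function.iterate_succ_apply']
      exact (ih.comp (continuous_add_const 1)).sub ih
  have hcl : IsClosed {x | 0 ≤ s * (fwdDiff (1 : ℝ))^[k] (fun y : ℝ => y ^ p) x} :=
    isClosed_le continuous_const (continuous_const.mul (hcont k))
  have hsub : Set.Ioi (0 : ℝ) ⊆ {x | 0 ≤ s * (fwdDiff (1 : ℝ))^[k] (fun y : ℝ => y ^ p) x} := by
    intro x hx
    obtain ⟨c, hc, h⟩ := exists_fwdDiff_iter_rpow_eq k p x hx
    simp only [Set.mem_ofPred_eq, h, ← mul_assoc]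
    positivity
  intro x hx
  exact hcl.closure_subset_iff.2 hsub (by rwa [closure_Ioi, Set.mem_Ici])

/-- The central fourth difference of `x ↦ |x| ^ p` at an integer. -/
noncomputable def fourthDiff (p : ℝ) (m : ℤ) : ℝ :=
  |((m + 2 : ℤ) : ℝ)| ^ p - 4 * |((m + 1 : ℤ) : ℝ)| ^ p + 6 * |(m : ℝ)| ^ p
    - 4 * |((m - 1 : ℤ) : ℝ)| ^ p + |((m - 2 : ℤ) : ℝ)| ^ p

theorem fourthDiff_neg (p : ℝ) (m : ℤ) : fourthDiff p (-m) = fourthDiff p m := by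
  have h : ∀ a b : ℤ, a = -b → |(a : ℝ)| = |(b : ℝ)| := by
    rintro a b rfl
    rw [Int.cast_neg, abs_neg]
  unfold fourthDiff
  rw [h (-m + 2) (m - 2) (by ring), h (-m + 1) (m - 1) (by ring), h (-m) m rfl,
    h (-m - 1) (m + 1) (by ring), h (-m - 2) (m + 2) (by ring)]
  ring

theorem fourthDiff_natCast_add_two (p : ℝ) (i : ℕ) :
    fourthDiff p (i + 2) = (fwdDiff (1 : ℝ))^[4] (fun y : ℝ => y ^ p) (i : ℝ) := by
  have h : ∀ (a : ℤ) (b : ℝ), 0 ≤ b → (a : ℝ) = b → |(a : ℝ)| = b := by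
    rintro a b hb rfl
    exact abs_of_nonneg hb
  unfold fourthDiff
  rw [h (i + 2 + 2) (i + 1 + 1 + 1 + 1) (by positivity) (by push_cast; ring),
    h (i + 2 + 1) (i + 1 + 1 + 1) (by positivity) (by push_cast; ring),
    h (i + 2) (i + 1 + 1) (by positivity) (by push_cast; ring),
    h (i + 2 - 1) (i + 1) (by positivity) (by push_cast; ring),
    h (i + 2 - 2) i (by positivity) (by push_cast; ring)]
  simp only [Function.iterate_succ_apply', Function.iterate_zero, id, fwdDiff]
  ring

theorem sum_range_abs_fourthDiff_le {p : ℝ} (hp0 : 0 < p) (hp2 : p < 2) (N : ℕ) :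
    ∑ i ∈ range N, |fourthDiff p (i + 2)| ≤ |3 ^ p - 3 * 2 ^ p + 3| := by
  obtain ⟨s, hs, h3, h4⟩ : ∃ s : ℝ, |s| = 1 ∧ 0 ≤ s * ∏ i ∈ range 3, (p - i) ∧
      0 ≤ -s * ∏ i ∈ range 4, (p - i) := by
    simp only [prod_range_succ, prod_range_zero]
    norm_num
    rcases le_total p 1 with h | h
    · have h3 : 0 ≤ p * (p - 1) * (p - 2) := by
        have := mul_nonneg (mul_nonneg hp0.le (sub_nonneg.2 h)) (sub_nonneg.2 hp2.le)
        linarith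
      exact ⟨1, by simp, by linarith, by nlinarith⟩
    · have h3 : p * (p - 1) * (p - 2) ≤ 0 := by
        have := mul_nonneg (mul_nonneg hp0.le (sub_nonneg.2 h)) (sub_nonneg.2 hp2.le)
        linarith
      exact ⟨-1, by simp, by linarith, by nlinarith⟩
  have hsum : ∑ i ∈ range N, |fourthDiff p (i + 2)| =
      s * (fwdDiff (1 : ℝ))^[3] (fun y : ℝ => y ^ p) 0 - s * (fwdDiff (1 : ℝ))^[3] (fun y : ℝ => y ^ p) N := by
    have := sum_range_sub' (fun i : ℕ => s * (fwdDiff (1 : ℝ))^[3] (fun y : ℝ => y ^ p) (i : ℝ)) N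
    rw [Nat.cast_zero] at this
    rw [← this]
    refine sum_congr rfl fun i _ => ?_
    have h := fwdDiff_iter_rpow_sign hp0.le 4 h4 i (Nat.cast_nonneg i)
    have habs : |fourthDiff p (i + 2)| = |-s * fourthDiff p (i + 2)| := by
      rw [abs_mul, abs_neg, hs, one_mul]
    rw [habs, fourthDiff_natCast_add_two, abs_of_nonneg h, Function.iterate_succ_apply', fwdDiff]
    push_cast
    ring
  have h0 : (fwdDiff (1 : ℝ))^[3] (fun y : ℝ => y ^ p) 0 = 3 ^ p - 3 * 2 ^ p + 3 := by
    simp only [Function.iterate_succ_apply', Function.iterate_zero, id, fwdDiff]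
    norm_num [Real.zero_rpow hp0.ne']
    ring
  have hN := fwdDiff_iter_rpow_sign hp0.le 3 h3 N (Nat.cast_nonneg N)
  rw [hsum, h0]
  calc _ ≤ s * (3 ^ p - 3 * 2 ^ p + 3) := by linarith
    _ ≤ |s * (3 ^ p - 3 * 2 ^ p + 3)| := le_abs_self _
    _ = _ := by rw [abs_mul, hs, one_mul]

theorem sum_abs_fourthDiff_le_of_two_le {p : ℝ} (hp0 : 0 < p) (hp2 : p < 2) (s : Finset ℤ)
    (hs : ∀ m ∈ s, 2 ≤ m) :
    ∑ m ∈ s, |fourthDiff p m| ≤ |3 ^ p - 3 * 2 ^ p + 3| := by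
  obtain ⟨M, hM⟩ := s.bddAbove
  have hinj : Function.Injective fun i : ℕ => (i : ℤ) + 2 := fun a b h => by
    simpa using h
  refine le_trans ?_ (sum_range_abs_fourthDiff_le hp0 hp2 M.toNat)
  rw [← sum_image (f := fun m : ℤ => |fourthDiff p m|) (g := fun i : ℕ => (i : ℤ) + 2)
    hinj.injOn]
  refine sum_le_sum_of_subset_of_nonneg (fun m hm => ?_) fun _ _ _ => abs_nonneg _
  have h1 := hs m hm
  have h2 : m ≤ M := hM hm
  exact mem_image.2 ⟨(m - 2).toNat, by rw [mem_range]; omega, by omega⟩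

theorem sum_abs_fourthDiff_le {p : ℝ} (hp0 : 0 < p) (hp2 : p < 2) (s : Finset ℤ) :
    ∑ m ∈ s, |fourthDiff p m| ≤
      2 * (4 - 2 ^ p) + 2 * |3 ^ p - 4 * 2 ^ p + 7| + 2 * |3 ^ p - 3 * 2 ^ p + 3| := by
  have hpos := sum_abs_fourthDiff_le_of_two_le hp0 hp2 {m ∈ s | 2 ≤ m}
    fun m hm => (mem_filter.1 hm).2
  have hneg := sum_abs_fourthDiff_le_of_two_le hp0 hp2 ({m ∈ s | m ≤ -2}.image Neg.neg) (by
    intro m hm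
    obtain ⟨a, ha, rfl⟩ := mem_image.1 hm
    have := (mem_filter.1 ha).2
    omega)
  rw [sum_image neg_injective.injOn] at hneg
  simp only [fourthDiff_neg] at hneg
  have h4 : (2 : ℝ) ^ p ≤ 4 := by
    have := Real.rpow_le_rpow_of_exponent_le (one_le_two (α := ℝ)) hp2.le
    norm_num at this
    exact this
  have h0 : |fourthDiff p 0| = 2 * (4 - 2 ^ p) := by
    have : fourthDiff p 0 = -(2 * (4 - 2 ^ p)) := by
      norm_num [fourthDiff, Real.zero_rpow hp0.ne']
      ring
    rw [this, abs_neg, abs_of_nonneg (by linarith)]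
  have h1 : fourthDiff p 1 = 3 ^ p - 4 * 2 ^ p + 7 := by
    norm_num [fourthDiff, Real.zero_rpow hp0.ne']
    ring
  have hmid : ∑ m ∈ ({-1, 0, 1} : Finset ℤ), |fourthDiff p m| =
      2 * (4 - 2 ^ p) + 2 * |3 ^ p - 4 * 2 ^ p + 7| := by
    rw [sum_insert (by decide), sum_insert (by decide), sum_singleton, fourthDiff_neg, h0, h1]
    ring
  have hsub : s ⊆ {m ∈ s | 2 ≤ m} ∪ ({m ∈ s | m ≤ -2} ∪ {-1, 0, 1}) := by
    intro m hm
    simp only [mem_union, mem_filter, mem_insert, mem_singleton, hm, true_and]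
    omega
  have hunion : ∀ a b : Finset ℤ, ∑ m ∈ a ∪ b, |fourthDiff p m| ≤
      ∑ m ∈ a, |fourthDiff p m| + ∑ m ∈ b, |fourthDiff p m| := fun a b => by
    rw [← sum_union_inter]
    exact le_add_of_nonneg_right (sum_nonneg fun _ _ => abs_nonneg _)
  have hle := sum_le_sum_of_subset_of_nonneg (f := fun m => |fourthDiff p m|) hsub
    fun _ _ _ => abs_nonneg _
  have hu1 := hunion {m ∈ s | 2 ≤ m} ({m ∈ s | m ≤ -2} ∪ {-1, 0, 1})
  have hu2 := hunion {m ∈ s | m ≤ -2} {-1, 0, 1}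
  linarith

theorem abs_differences_le {p : ℝ} (hp0 : 0 < p) (hp2 : p < 2) :
    2 * (4 - 2 ^ p) + 2 * |(3 : ℝ) ^ p - 4 * 2 ^ p + 7| + 3 * |(3 : ℝ) ^ p - 3 * 2 ^ p + 3| ≤
      9 * (4 - 2 ^ p) := by
  have hx1 : (1 : ℝ) ≤ 2 ^ p := Real.one_le_rpow one_le_two hp0.le
  have hx4 : (2 : ℝ) ^ p ≤ 4 := by
    have := Real.rpow_le_rpow_of_exponent_le (one_le_two (α := ℝ)) hp2.le
    norm_num at this
    exact this
  have hy : 9 / 16 * ((2 : ℝ) ^ p) ^ 2 ≤ 3 ^ p := by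
    have h := Real.rpow_le_rpow_of_nonpos (by norm_num : (0 : ℝ) < 3)
      (by norm_num : (3 : ℝ) ≤ 4) (sub_nonpos.2 hp2.le)
    rw [Real.rpow_sub (by norm_num), Real.rpow_sub (by norm_num),
      show (4 : ℝ) = 2 * 2 by norm_num, Real.mul_rpow (by norm_num) (by norm_num)] at h
    norm_num at h
    nlinarith
  have hle : (3 : ℝ) ^ p ≤ 2 * 2 ^ p + 1 := by
    have h1 := Real.rpow_le_rpow_of_exponent_ge (by norm_num : (0 : ℝ) < 1 / 3)
      (by norm_num) hp2.le
    have h2 := Real.rpow_le_rpow_of_exponent_ge (by norm_num : (0 : ℝ) < 2 / 3)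
      (by norm_num) hp2.le
    have h3 : (0 : ℝ) < 3 ^ p := by positivity
    rw [Real.div_rpow (by norm_num) (by norm_num) p, le_div_iff₀ h3] at h1 h2
    norm_num at h1 h2
    linarith
  have h9 : (3 : ℝ) ^ p ≤ 9 := by linarith
  generalize (2 : ℝ) ^ p = x at *
  generalize (3 : ℝ) ^ p = y at *
  have hq1 : 8 * x ≤ 23 + y := by nlinarith
  have hq2 : 24 * x ≤ 51 + 5 * y := by nlinarith
  rcases abs_cases (y - 4 * x + 7) with ⟨h, -⟩ | ⟨h, -⟩ <;>
    rcases abs_cases (y - 3 * x + 3) with ⟨h', -⟩ | ⟨h', -⟩ <;> rw [h, h'] <;> linarith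

/-- Uniform bound `max_k ∑_j |d^{S^H,n}_{jk}| ≤ 9/2` for the normalized covariances
of the second-order increments of sub-fractional Brownian motion. -/
theorem stmt_9 (H : ℝ) (hH : H ∈ Set.Ioo (0 : ℝ) 1) (hH2 : H ≠ 1 / 2)
    (T : ℝ) (hT : 0 < T) (n : ℕ) (hn : 2 ≤ n)
    (t : ℤ → ℝ) (ht : ∀ i, t i = (i : ℝ) * T / n)
    (G : ℝ → ℝ → ℝ)
    (hG : ∀ s u, G s u = s ^ (2 * H) + u ^ (2 * H)
      - (1 / 2) * ((s + u) ^ (2 * H) + |s - u| ^ (2 * H)))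
    (w : ℤ → ℝ) (hwm : w (-1) = 1) (hw0 : w 0 = -2) (hw1 : w 1 = 1)
    (dhat : ℤ → ℤ → ℝ)
    (hdhat : ∀ j k, dhat j k = ∑ a ∈ Finset.Icc (-1 : ℤ) 1, ∑ b ∈ Finset.Icc (-1 : ℤ) 1,
      w a * w b * G (t (j + a)) (t (k + b)))
    (d : ℤ → ℤ → ℝ)
    (hd : ∀ j k, d j k = (n : ℝ) ^ (2 * H) / (T ^ (2 * H) * (4 - 2 ^ (2 * H))) * dhat j k) :
    ∀ k : ℤ, 1 ≤ k → k ≤ (n : ℤ) - 1 →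
      ∑ j ∈ Finset.Icc (1 : ℤ) ((n : ℤ) - 1), |d j k| ≤ 9 / 2 := by
  obtain ⟨hH0, hH1⟩ := hH
  intro k hk hkn
  obtain ⟨p, hp⟩ : ∃ p, p = 2 * H := ⟨_, rfl⟩
  rw [← hp] at hG hd
  have hp0 : 0 < p := by linarith
  have hp2 : p < 2 := by linarith
  have hn0 : (0 : ℝ) < n := by positivity
  have hTn : 0 < T / n := by positivity
  have h4 : (2 : ℝ) ^ p < 4 := by
    have := Real.rpow_lt_rpow_of_exponent_lt (one_lt_two (α := ℝ)) hp2
    norm_num at this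
    exact this
  have hGt : ∀ i l : ℤ, 0 ≤ i → 0 ≤ l → G (t i) (t l) = (T / n) ^ p *
      (|(i : ℝ)| ^ p + |(l : ℝ)| ^ p
        - (1 / 2) * (|((i + l : ℤ) : ℝ)| ^ p + |((i - l : ℤ) : ℝ)| ^ p)) := by
    intro i l hi hl
    have hi' : (0 : ℝ) ≤ i := Int.cast_nonneg hi
    have hl' : (0 : ℝ) ≤ l := Int.cast_nonneg hl
    have e1 : t i = T / n * |(i : ℝ)| := by rw [ht, abs_of_nonneg hi']; ring
    have e2 : t l = T / n * |(l : ℝ)| := by rw [ht, abs_of_nonneg hl']; ring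
    have e3 : t i + t l = T / n * |((i + l : ℤ) : ℝ)| := by
      rw [ht, ht, abs_of_nonneg (by push_cast; positivity)]; push_cast; ring
    have e4 : |t i - t l| = T / n * |((i - l : ℤ) : ℝ)| := by
      rw [← abs_of_pos hTn, ← abs_mul, ht, ht]; push_cast; congr 1; ring
    rw [hG, e3, e4, e1, e2]
    simp only [Real.mul_rpow hTn.le (abs_nonneg _)]
    ring
  have hdk : ∀ j : ℤ, 1 ≤ j → d j k =
      -(fourthDiff p (j - k) + fourthDiff p (j + k)) / (2 * (4 - 2 ^ p)) := by
    intro j hj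
    have hIcc : Icc (-1 : ℤ) 1 = {-1, 0, 1} := by decide
    have hdh : dhat j k =
        (T / n) ^ p * (-(1 / 2) * (fourthDiff p (j - k) + fourthDiff p (j + k))) := by
      rw [hdhat, hIcc]
      simp only [sum_insert (show (-1 : ℤ) ∉ ({0, 1} : Finset ℤ) by decide),
        sum_insert (show (0 : ℤ) ∉ ({1} : Finset ℤ) by decide), sum_singleton, hwm, hw0, hw1]
      simp only [hGt (j + -1) (k + -1) (by omega) (by omega),
        hGt (j + -1) (k + 0) (by omega) (by omega), hGt (j + -1) (k + 1) (by omega) (by omega),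
        hGt (j + 0) (k + -1) (by omega) (by omega), hGt (j + 0) (k + 0) (by omega) (by omega),
        hGt (j + 0) (k + 1) (by omega) (by omega), hGt (j + 1) (k + -1) (by omega) (by omega),
        hGt (j + 1) (k + 0) (by omega) (by omega), hGt (j + 1) (k + 1) (by omega) (by omega)]
      unfold fourthDiff
      push_cast
      ring_nf
    have hT' : T ^ p ≠ 0 := by positivity
    have hn' : (n : ℝ) ^ p ≠ 0 := by positivity
    have h4' : 4 - (2 : ℝ) ^ p ≠ 0 := by linarith
    rw [hd, hdh, Real.div_rpow hT.le hn0.le]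
    field_simp
  have hbound : ∀ j ∈ Icc (1 : ℤ) (n - 1), |d j k| ≤
      (|fourthDiff p (j - k)| + |fourthDiff p (j + k)|) / (2 * (4 - 2 ^ p)) := by
    intro j hj
    have hpos : 0 < 2 * (4 - (2 : ℝ) ^ p) := by linarith
    rw [hdk j (mem_Icc.1 hj).1, abs_div, abs_neg, abs_of_pos hpos]
    gcongr
    exact abs_add_le _ _
  have hsub := sum_abs_fourthDiff_le hp0 hp2 ((Icc (1 : ℤ) (n - 1)).image (· - k))
  have hadd := sum_abs_fourthDiff_le_of_two_le hp0 hp2 ((Icc (1 : ℤ) (n - 1)).image (· + k)) (by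
    intro m hm
    obtain ⟨a, ha, rfl⟩ := mem_image.1 hm
    have := (mem_Icc.1 ha).1
    omega)
  rw [sum_image (sub_left_injective.injOn)] at hsub
  rw [sum_image ((add_left_injective k).injOn)] at hadd
  have hdiff := abs_differences_le hp0 hp2
  refine (sum_le_sum hbound).trans ?_
  rw [← sum_div, sum_add_distrib, div_le_iff₀ (by linarith)]
  linarith
end

section
/- Let K in (0,1), H in (0,1/2), T > 0, and let n >= 2 be an integer. For integers k >= 1 define b(k,H,K) := 2[(k+1)^{2H} + k^{2H}]^K + 2[k^{2H} + (k-1)^{2H}]^K - 2^{K-1}[(k+1)^{2KH} + 4 k^{2KH} + (k-1)^{2KH}] - [(k+1)^{2H} + (k-1)^{2H}]^K and d^{B^{KH}}_{kk} := 1 - b(k,H,K)/(4 - 4^{KH}). Then |(1/(n-1)) * sum_{k=1}^{n-1} d^{B^{KH}}_{kk} - 1| <= (T/n)^{1/2} * ( (1/(6T)) * n/(n-1) + 22/(9 * ln 4) ). -/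
/-- The Jensen gap of `x ↦ x ^ K` between `2 y ^ a` and `2 x ^ a`. -/
noncomputable def jensenGap (K a x y : ℝ) : ℝ :=
  (y ^ a + x ^ a) ^ K - 2 ^ (K - 1) * (y ^ (K * a) + x ^ (K * a))

theorem two_rpow_sub_one (K : ℝ) : (2 : ℝ) ^ (K - 1) = 2 ^ K / 2 := by
  rw [Real.rpow_sub (by norm_num), Real.rpow_one]

theorem jensenGap_nonneg {K a x y : ℝ} (hK₀ : 0 < K) (hK₁ : K < 1) (hx : 0 ≤ x) (hy : 0 ≤ y) :
    0 ≤ jensenGap K a x y := by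
  have hxa := Real.rpow_nonneg hx a
  have hya := Real.rpow_nonneg hy a
  have h := (Real.concaveOn_rpow hK₀.le hK₁.le).2
    (show 2 * y ^ a ∈ Set.Ici 0 by simpa using hya) (show 2 * x ^ a ∈ Set.Ici 0 by simpa using hxa)
    (show (0 : ℝ) ≤ 1 / 2 by norm_num) (show (0 : ℝ) ≤ 1 / 2 by norm_num) (by norm_num)
  simp only [smul_eq_mul] at h
  rw [Real.mul_rpow (by norm_num) hya, Real.mul_rpow (by norm_num) hxa, ← Real.rpow_mul hx,
    ← Real.rpow_mul hy, mul_comm a K,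
    show 1 / 2 * (2 * y ^ a) + 1 / 2 * (2 * x ^ a) = y ^ a + x ^ a by ring] at h
  rw [jensenGap, two_rpow_sub_one]
  linarith

theorem one_add_rpow_lower {K s : ℝ} (hK₀ : 0 < K) (hK₁ : K < 1) (hs : 0 ≤ s) :
    1 + K * s - K * (1 - K) * s ^ 2 ≤ (1 + s) ^ K := by
  have hs1 : 0 < 1 + s := by linarith
  have h := rpow_one_add_le_one_add_mul_self (s := -(s / (1 + s))) (p := K)
    (by rw [neg_le_neg_iff, div_le_one hs1]; linarith) hK₀.le hK₁.le
  have e : 1 + -(s / (1 + s)) = (1 + s)⁻¹ := by field_simp; ring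
  rw [e, Real.inv_rpow hs1.le] at h
  have hp : 0 < (1 + s) ^ K := Real.rpow_pos_of_pos hs1 K
  have hden : 0 < 1 + (1 - K) * s := by nlinarith
  have e2 : 1 + K * -(s / (1 + s)) = (1 + (1 - K) * s) / (1 + s) := by field_simp; ring
  rw [e2, inv_le_comm₀ hp (by positivity), inv_div] at h
  refine le_trans ?_ h
  rw [le_div_iff₀ hden]
  have h3 : 0 ≤ K * (1 - K) ^ 2 * s ^ 3 := by positivity
  nlinarith

theorem jensenGap_le {K a x y : ℝ} (hK₀ : 0 < K) (hK₁ : K < 1) (ha₀ : 0 < a) (ha₁ : a < 1)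
    (hx : 1 ≤ x) (hxy : x ≤ y) : jensenGap K a x y ≤ (y - x) ^ 2 / (4 * x) := by
  have hx0 : 0 < x := by linarith
  have hy0 : 0 < y := by linarith
  obtain ⟨s, hs⟩ : ∃ s, (y / x) ^ a = 1 + s := ⟨(y / x) ^ a - 1, by ring⟩
  have hs0 : 0 ≤ s := by
    have := Real.one_le_rpow ((one_le_div hx0).2 hxy) ha₀.le
    linarith
  have hs1 : s ≤ (y - x) / x := by
    have := Real.rpow_le_rpow_of_exponent_le ((one_le_div hx0).2 hxy) ha₁.le
    rw [Real.rpow_one] at this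
    rw [sub_div, div_self hx0.ne']
    linarith
  have hya : y ^ a = x ^ a * (1 + s) := by
    rw [← hs, ← Real.mul_rpow hx0.le (by positivity), mul_div_cancel₀ _ hx0.ne']
  have hxa : 0 < x ^ a := Real.rpow_pos_of_pos hx0 a
  have hxK : x ^ (K * a) ≤ x := by
    have := Real.rpow_le_rpow_of_exponent_le hx (show K * a ≤ 1 by nlinarith)
    rwa [Real.rpow_one] at this
  have h2K : (2 : ℝ) ^ K ≤ 2 := by
    have := Real.rpow_le_rpow_of_exponent_le (x := 2) (by norm_num) hK₁.le
    rwa [Real.rpow_one] at this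
  have h2K0 : (0 : ℝ) < 2 ^ K := by positivity
  have hlow := one_add_rpow_lower hK₀ hK₁ hs0
  have hup := rpow_one_add_le_one_add_mul_self (s := s / 2) (p := K)
    (by linarith) hK₀.le hK₁.le
  have hKK : K * (1 - K) ≤ 1 / 4 := by nlinarith [sq_nonneg (K - 1 / 2)]
  have e : jensenGap K a x y =
      x ^ (K * a) * (2 ^ K * ((1 + s / 2) ^ K - ((1 + s) ^ K + 1) / 2)) := by
    rw [jensenGap, two_rpow_sub_one, mul_comm K a, Real.rpow_mul hx0.le, Real.rpow_mul hy0.le, hya,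
      show x ^ a * (1 + s) + x ^ a = x ^ a * (2 * (1 + s / 2)) by ring,
      Real.mul_rpow hxa.le (by positivity), Real.mul_rpow hxa.le (by positivity),
      Real.mul_rpow (by norm_num) (by positivity)]
    ring
  have hin : 2 ^ K * ((1 + s / 2) ^ K - ((1 + s) ^ K + 1) / 2) ≤ s ^ 2 / 4 := by
    have h1 : (1 + s / 2) ^ K - ((1 + s) ^ K + 1) / 2 ≤ s ^ 2 / 8 := by
      nlinarith [mul_le_mul_of_nonneg_right hKK (sq_nonneg s)]
    calc _ ≤ 2 ^ K * (s ^ 2 / 8) := by gcongr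
      _ ≤ 2 * (s ^ 2 / 8) := by gcongr
      _ = s ^ 2 / 4 := by ring
  calc jensenGap K a x y ≤ x ^ (K * a) * (s ^ 2 / 4) := by rw [e]; gcongr
    _ ≤ x * (((y - x) / x) ^ 2 / 4) := by gcongr
    _ = (y - x) ^ 2 / (4 * x) := by field_simp

theorem jensenGap_zero_one_le {K a : ℝ} (hK₀ : 0 < K) (ha₀ : 0 < a) :
    jensenGap K a 0 1 ≤ 1 / 2 := by
  rw [jensenGap, two_rpow_sub_one, Real.zero_rpow ha₀.ne', Real.zero_rpow (by positivity)]
  have : (1 : ℝ) ≤ 2 ^ K := Real.one_le_rpow (by norm_num) hK₀.le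
  simp only [Real.one_rpow, add_zero]
  linarith

theorem jensenGap_zero_two_le {K a : ℝ} (hK₀ : 0 < K) (hK₁ : K < 1) (ha₀ : 0 < a) (ha₁ : a < 1) :
    jensenGap K a 0 2 ≤ 1 / 2 := by
  rw [jensenGap, two_rpow_sub_one, Real.zero_rpow ha₀.ne', Real.zero_rpow (by positivity),
    add_zero, add_zero, ← Real.rpow_mul (by norm_num), mul_comm a K]
  have h2K : (2 : ℝ) ^ K ≤ 2 := by
    have := Real.rpow_le_rpow_of_exponent_le (x := 2) (by norm_num) hK₁.le
    rwa [Real.rpow_one] at this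
  have h : (2 : ℝ) ^ (K * a) ≤ 2 ^ K :=
    Real.rpow_le_rpow_of_exponent_le (by norm_num) (by nlinarith)
  nlinarith [sq_nonneg ((2 : ℝ) ^ K - 1), mul_nonneg (sub_nonneg.2 h) (sub_nonneg.2 h2K)]

theorem inv_add_one_le_sqrt_sub {x : ℝ} (hx : 0 ≤ x) :
    1 / (x + 1) ≤ 2 * √(x + 1) - 2 * √x := by
  have h1 : 1 ≤ √(x + 1) := Real.one_le_sqrt.2 (by linarith)
  have h2 : √x ≤ √(x + 1) := Real.sqrt_le_sqrt (by linarith)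
  have e1 := Real.sq_sqrt hx
  have e2 := Real.sq_sqrt (show 0 ≤ x + 1 by linarith)
  have h0 := Real.sqrt_nonneg x
  rw [div_le_iff₀ (by linarith)]
  have h3 : 1 ≤ (√(x + 1) - √x) * (2 * √(x + 1)) := by nlinarith
  have h4 : √(x + 1) ≤ x + 1 := by nlinarith
  nlinarith [mul_le_mul_of_nonneg_left h4 (sub_nonneg.2 h2)]

theorem abs_sum_le_two_sqrt {b : ℕ → ℝ} (h₁ : b 1 ≤ 3 / 2) (h₁' : -(1 / 2) ≤ b 1)
    (hu : ∀ m : ℕ, 1 ≤ m → b (m + 1) ≤ 1 / 2 * (1 / ((m : ℝ) + 1) + 1 / m))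
    (hl : ∀ m : ℕ, 1 ≤ m → -(1 / (m : ℝ)) ≤ b (m + 1)) (m : ℕ) (hm : 1 ≤ m) :
    |∑ k ∈ Finset.Icc 1 m, b k| ≤ 2 * √m := by
  have key : ∑ k ∈ Finset.Icc 1 m, b k ≤ 2 * √m - 1 / 2 * (1 / (m : ℝ)) ∧
      -(2 * √m - 1 / (m : ℝ)) ≤ ∑ k ∈ Finset.Icc 1 m, b k := by
    induction m, hm using Nat.le_induction with
    | base => simp; constructor <;> linarith
    | succ m hm ih =>
      rw [Finset.sum_Icc_succ_top (by omega)]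
      have h := inv_add_one_le_sqrt_sub (Nat.cast_nonneg (α := ℝ) m)
      have := hu m hm
      have := hl m hm
      push_cast
      constructor <;> linarith [ih.1, ih.2]
  have : 0 ≤ 1 / (m : ℝ) := by positivity
  rw [abs_le]
  constructor <;> linarith [key.1, key.2]

theorem inv_sqrt_le_bound {T n : ℝ} (hT : 0 < T) (hn : 1 < n) :
    1 / √(n - 1) ≤ (T / n) ^ ((1 : ℝ) / 2) *
      ((1 / (6 * T)) * (n / (n - 1)) + 22 / (9 * Real.log 4)) := by
  have hm : 0 < n - 1 := by linarith
  have hn0 : 0 < n := by linarith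
  have hlog : Real.log 4 < 1.4 := by
    rw [show (4 : ℝ) = 2 ^ 2 by norm_num, Real.log_pow]
    have := Real.log_two_lt_d9
    push_cast
    linarith
  have hlog0 : 0 < Real.log 4 := Real.log_pos (by norm_num)
  have hc : 3 / 2 ≤ 22 / (9 * Real.log 4) := by
    rw [le_div_iff₀ (by positivity)]
    linarith
  set c := 22 / (9 * Real.log 4)
  rw [← Real.sqrt_eq_rpow]
  have hpos : 0 ≤ √(T / n) * (1 / (6 * T) * (n / (n - 1)) + c) := by positivity
  refine (sq_le_sq₀ (by positivity) hpos).1 ?_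
  rw [div_pow, Real.sq_sqrt hm.le, mul_pow, Real.sq_sqrt (by positivity)]
  have h1 : 4 * (1 / (6 * T) * (n / (n - 1))) * c ≤ (1 / (6 * T) * (n / (n - 1)) + c) ^ 2 := by
    nlinarith [sq_nonneg (1 / (6 * T) * (n / (n - 1)) - c)]
  calc 1 ^ 2 / (n - 1) = T / n * (4 * (1 / (6 * T) * (n / (n - 1))) * (3 / 2)) := by
        field_simp; norm_num
    _ ≤ T / n * (4 * (1 / (6 * T) * (n / (n - 1))) * c) := by gcongr
    _ ≤ _ := by gcongr


/-- Bound on the deviation of the mean normalized diagonal covariances of the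
second-order increments of bifractional Brownian motion. -/
theorem stmt_13 (K H : ℝ) (hK : K ∈ Set.Ioo (0 : ℝ) 1) (hH : H ∈ Set.Ioo (0 : ℝ) (1 / 2))
    (T : ℝ) (hT : 0 < T) (n : ℕ) (hn : 2 ≤ n)
    (b : ℕ → ℝ)
    (hb : ∀ k, 1 ≤ k → b k =
      2 * (((k : ℝ) + 1) ^ (2 * H) + (k : ℝ) ^ (2 * H)) ^ K
      + 2 * ((k : ℝ) ^ (2 * H) + ((k : ℝ) - 1) ^ (2 * H)) ^ K
      - 2 ^ (K - 1) * (((k : ℝ) + 1) ^ (2 * K * H) + 4 * (k : ℝ) ^ (2 * K * H)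
          + ((k : ℝ) - 1) ^ (2 * K * H))
      - (((k : ℝ) + 1) ^ (2 * H) + ((k : ℝ) - 1) ^ (2 * H)) ^ K)
    (d : ℕ → ℝ) (hd : ∀ k, 1 ≤ k → d k = 1 - b k / (4 - 4 ^ (K * H))) :
    |(1 / ((n : ℝ) - 1)) * ∑ k ∈ Finset.Icc 1 (n - 1), d k - 1|
      ≤ (T / n) ^ ((1 : ℝ) / 2) *
        ((1 / (6 * T)) * ((n : ℝ) / ((n : ℝ) - 1)) + 22 / (9 * Real.log 4)) := by
  obtain ⟨hK₀, hK₁⟩ := hK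
  obtain ⟨hH₀, hH₁⟩ := hH
  have ha₀ : 0 < 2 * H := by linarith
  have ha₁ : 2 * H < 1 := by linarith
  have hb' : ∀ k, 1 ≤ k → b k = 2 * jensenGap K (2 * H) k (k + 1)
      + 2 * jensenGap K (2 * H) (k - 1) k - jensenGap K (2 * H) (k - 1) (k + 1) := by
    intro k hk
    rw [hb k hk, jensenGap, jensenGap, jensenGap, show 2 * K * H = K * (2 * H) by ring]
    ring
  have hS := abs_sum_le_two_sqrt (b := b)
    (by
      have h := hb' 1 le_rfl
      have h1 := jensenGap_le hK₀ hK₁ ha₀ ha₁ (le_refl 1) (show (1 : ℝ) ≤ 1 + 1 by norm_num)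
      have h2 := jensenGap_zero_one_le hK₀ ha₀
      have h3 := jensenGap_nonneg (a := 2 * H) hK₀ hK₁ le_rfl (show (0 : ℝ) ≤ 1 + 1 by norm_num)
      norm_num at h h1 h2 h3
      linarith)
    (by
      have h := hb' 1 le_rfl
      have h1 := jensenGap_nonneg (a := 2 * H) hK₀ hK₁ zero_le_one
        (show (0 : ℝ) ≤ 1 + 1 by norm_num)
      have h2 := jensenGap_nonneg (a := 2 * H) hK₀ hK₁ le_rfl (zero_le_one (α := ℝ))
      have h3 := jensenGap_zero_two_le hK₀ hK₁ ha₀ ha₁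
      norm_num at h h1 h2 h3
      linarith)
    (by
      intro m hm
      have hm' : (1 : ℝ) ≤ m := by exact_mod_cast hm
      have h := hb' (m + 1) (by omega)
      have h1 := jensenGap_le (x := (m : ℝ) + 1) (y := m + 1 + 1) hK₀ hK₁ ha₀ ha₁
        (by linarith) (by linarith)
      have h2 := jensenGap_le (x := (m : ℝ)) (y := m + 1) hK₀ hK₁ ha₀ ha₁ hm' (by linarith)
      have h3 := jensenGap_nonneg (a := 2 * H) (x := m) (y := m + 1 + 1) hK₀ hK₁
        (by linarith) (by linarith)
      push_cast at h
      rw [add_sub_cancel_right] at h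
      have e1 : ((m : ℝ) + 1 + 1 - (m + 1)) ^ 2 / (4 * (m + 1)) = 1 / 4 * (1 / (m + 1)) := by
        field_simp; ring
      have e2 : ((m : ℝ) + 1 - m) ^ 2 / (4 * m) = 1 / 4 * (1 / m) := by
        field_simp; ring
      linarith)
    (by
      intro m hm
      have hm' : (1 : ℝ) ≤ m := by exact_mod_cast hm
      have h := hb' (m + 1) (by omega)
      have h1 := jensenGap_nonneg (a := 2 * H) (x := (m : ℝ) + 1) (y := m + 1 + 1) hK₀ hK₁
        (by linarith) (by linarith)
      have h2 := jensenGap_nonneg (a := 2 * H) (x := (m : ℝ)) (y := m + 1) hK₀ hK₁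
        (by linarith) (by linarith)
      have h3 := jensenGap_le (x := (m : ℝ)) (y := m + 1 + 1) hK₀ hK₁ ha₀ ha₁ hm' (by linarith)
      push_cast at h
      rw [add_sub_cancel_right] at h
      have e : ((m : ℝ) + 1 + 1 - m) ^ 2 / (4 * m) = 1 / m := by
        field_simp; ring
      linarith) (n - 1) (by omega)
  have hn' : (1 : ℝ) < n := by exact_mod_cast hn
  have hm : 0 < (n : ℝ) - 1 := by linarith
  rw [Nat.cast_sub (by omega), Nat.cast_one] at hS
  have hD : 2 ≤ (4 : ℝ) - 4 ^ (K * H) := by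
    have h := Real.rpow_le_rpow_of_exponent_le (x := 4) (by norm_num)
      (show K * H ≤ 1 / 2 by nlinarith)
    rw [← Real.sqrt_eq_rpow, show (4 : ℝ) = 2 ^ 2 by norm_num,
      Real.sqrt_sq (by norm_num)] at h
    norm_num at h
    linarith
  have hsum : (1 / ((n : ℝ) - 1)) * ∑ k ∈ Finset.Icc 1 (n - 1), d k - 1 =
      -((∑ k ∈ Finset.Icc 1 (n - 1), b k) / (((n : ℝ) - 1) * (4 - 4 ^ (K * H)))) := by
    rw [Finset.sum_congr rfl fun k hk => hd k (Finset.mem_Icc.1 hk).1, Finset.sum_sub_distrib,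
      ← Finset.sum_div]
    simp only [Finset.sum_const, Nat.card_Icc, add_tsub_cancel_right, nsmul_eq_mul, mul_one]
    rw [Nat.cast_sub (by omega), Nat.cast_one]
    field_simp
    ring
  rw [hsum, abs_neg, abs_div, abs_of_pos (a := ((n : ℝ) - 1) * _) (by positivity)]
  refine le_trans ?_ (inv_sqrt_le_bound hT hn')
  calc _ ≤ 2 * √((n : ℝ) - 1) / (((n : ℝ) - 1) * 2) := by gcongr
    _ = 1 / √((n : ℝ) - 1) := by
      have := Real.sq_sqrt hm.le
      have := Real.sqrt_pos.2 hm
      field_simp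
      linarith
end

section
/- Let K in (0,1), H in (0,1/2), and let k >= 2 be an integer. With b(k,H,K) := 2[(k+1)^{2H} + k^{2H}]^K + 2[k^{2H} + (k-1)^{2H}]^K - 2^{K-1}[(k+1)^{2KH} + 4 k^{2KH} + (k-1)^{2KH}] - [(k+1)^{2H} + (k-1)^{2H}]^K, the bound |b(k,H,K)| / (4 - 4^{KH}) <= (22/(9 * ln 4)) * k^{-1} holds. -/
lemma rpow_le_tangent {x y q : ℝ} (hx : 0 < x) (hy : 0 < y) (hq : 0 ≤ q) (hq1 : q ≤ 1) :
    x ^ q ≤ y ^ q + q * y ^ (q - 1) * (x - y) := by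
  have h := rpow_one_add_le_one_add_mul_self (s := x / y - 1)
    (by have := div_pos hx hy; linarith) hq hq1
  rw [add_sub_cancel, Real.div_rpow hx.le hy.le,
    div_le_iff₀ (Real.rpow_pos_of_pos hy q)] at h
  refine h.trans_eq ?_
  rw [Real.rpow_sub_one hy.ne']
  field_simp

/-- The defect in midpoint concavity of `x ↦ x ^ K`, rescaled by `2 ^ K`. -/
noncomputable def midpointDefect (K x y : ℝ) : ℝ :=
  (x + y) ^ K - 2 ^ (K - 1) * (x ^ K + y ^ K)

lemma midpointDefect_eq {K x y : ℝ} (hx : 0 < x) (hy : 0 < y) :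
    midpointDefect K x y = 2 ^ K * (((x + y) / 2) ^ K - (x ^ K + y ^ K) / 2) := by
  rw [midpointDefect, Real.div_rpow (by positivity) (by norm_num), Real.rpow_sub_one (by norm_num)]
  have : (2 : ℝ) ^ K ≠ 0 := by positivity
  field_simp

lemma midpointDefect_nonneg {K x y : ℝ} (hK : 0 ≤ K) (hK1 : K ≤ 1) (hx : 0 < x) (hy : 0 < y) :
    0 ≤ midpointDefect K x y := by
  rw [midpointDefect_eq hx hy]
  have hm : 0 < (x + y) / 2 := by positivity
  have h1 := rpow_le_tangent hx hm hK hK1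
  have h2 := rpow_le_tangent hy hm hK hK1
  refine mul_nonneg (by positivity) ?_
  linarith

lemma rpow_sub_rpow_le_of_neg_exponent {K x y : ℝ} (hK : 0 ≤ K) (hK1 : K ≤ 1) (hy : 0 < y)
    (hyx : y ≤ x) : y ^ (K - 1) - x ^ (K - 1) ≤ (1 - K) * y ^ (K - 2) * (x - y) := by
  have hx : 0 < x := hy.trans_le hyx
  have h := rpow_le_tangent hx hy (sub_nonneg.2 hK1) (by linarith : 1 - K ≤ 1)
  have hxy : x ^ (K - 1) ≤ y ^ (K - 1) :=
    Real.rpow_le_rpow_of_nonpos hy hyx (by linarith)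
  have hmulx : x ^ (K - 1) * x ^ (1 - K) = 1 := by
    rw [← Real.rpow_add hx]; simp
  have hmuly : y ^ (K - 1) * y ^ (1 - K) = 1 := by
    rw [← Real.rpow_add hy]; simp
  have hexp : y ^ (K - 1) * y ^ (1 - K - 1) * y ^ (K - 1) = y ^ (K - 2) := by
    rw [← Real.rpow_add hy, ← Real.rpow_add hy]; congr 1; ring
  have hyK := Real.rpow_pos_of_pos hy (K - 1)
  have hxK := Real.rpow_pos_of_pos hx (K - 1)
  calc y ^ (K - 1) - x ^ (K - 1)
      = y ^ (K - 1) * x ^ (K - 1) * (x ^ (1 - K) - y ^ (1 - K)) := by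
        linear_combination (-y ^ (K - 1)) * hmulx + x ^ (K - 1) * hmuly
    _ ≤ y ^ (K - 1) * x ^ (K - 1) * ((1 - K) * y ^ (1 - K - 1) * (x - y)) := by
        gcongr; linarith
    _ ≤ y ^ (K - 1) * y ^ (K - 1) * ((1 - K) * y ^ (1 - K - 1) * (x - y)) := by
        have h1 : 0 ≤ 1 - K := by linarith
        have h2 : 0 ≤ x - y := by linarith
        gcongr
    _ = (1 - K) * y ^ (K - 2) * (x - y) := by rw [← hexp]; ring

lemma midpointDefect_le {K x y : ℝ} (hK : 0 ≤ K) (hK1 : K ≤ 1) (hy : 0 < y) (hyx : y ≤ x) :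
    midpointDefect K x y ≤ y ^ (K - 2) * (x - y) ^ 2 / 8 := by
  have hx : 0 < x := hy.trans_le hyx
  have hm : 0 < (x + y) / 2 := by positivity
  rw [midpointDefect_eq hx hy]
  have h1 := rpow_le_tangent hm hy hK hK1
  have h2 := rpow_le_tangent hm hx hK hK1
  have h3 := rpow_sub_rpow_le_of_neg_exponent hK hK1 hy hyx
  have hd : 0 ≤ x - y := sub_nonneg.2 hyx
  have h4 := mul_le_mul_of_nonneg_left h3 (mul_nonneg hK hd)
  have hyp := Real.rpow_pos_of_pos hy (K - 2)
  have h5 : K * (1 - K) * (y ^ (K - 2) * (x - y) ^ 2) ≤ 1 / 4 * (y ^ (K - 2) * (x - y) ^ 2) := by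
    gcongr
    nlinarith [sq_nonneg (K - 1 / 2)]
  have h2K : (2 : ℝ) ^ K ≤ 2 := by
    simpa using Real.rpow_le_rpow_of_exponent_le (by norm_num : (1 : ℝ) ≤ 2) hK1
  have hbound : ((x + y) / 2) ^ K - (x ^ K + y ^ K) / 2 ≤ y ^ (K - 2) * (x - y) ^ 2 / 16 := by
    linarith
  calc (2 : ℝ) ^ K * (((x + y) / 2) ^ K - (x ^ K + y ^ K) / 2)
      ≤ 2 ^ K * (y ^ (K - 2) * (x - y) ^ 2 / 16) := by gcongr
    _ ≤ 2 * (y ^ (K - 2) * (x - y) ^ 2 / 16) := by gcongr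
    _ = _ := by ring

lemma midpointDefect_rpow_le {K p s t : ℝ} (hK : 0 ≤ K) (hK1 : K ≤ 1) (hp : 0 ≤ p) (hp1 : p ≤ 1)
    (hs : 1 ≤ s) (hst : s ≤ t) :
    midpointDefect K (t ^ p) (s ^ p) ≤ (t - s) ^ 2 / (8 * s) := by
  have hs0 : 0 < s := by linarith
  have ht0 : 0 < t := by linarith
  have hmono : s ^ p ≤ t ^ p := Real.rpow_le_rpow hs0.le hst hp
  have htan := rpow_le_tangent ht0 hs0 hp hp1
  have hd : 0 ≤ t - s := sub_nonneg.2 hst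
  have hdiff : t ^ p - s ^ p ≤ s ^ (p - 1) * (t - s) := by
    have : p * (s ^ (p - 1) * (t - s)) ≤ 1 * (s ^ (p - 1) * (t - s)) := by gcongr
    linarith
  have hexp : (s ^ p) ^ (K - 2) * (s ^ (p - 1)) ^ 2 ≤ s⁻¹ := by
    rw [← Real.rpow_natCast, ← Real.rpow_mul hs0.le, ← Real.rpow_mul hs0.le,
      ← Real.rpow_add hs0, ← Real.rpow_neg_one]
    apply Real.rpow_le_rpow_of_exponent_le hs
    push_cast
    nlinarith
  calc midpointDefect K (t ^ p) (s ^ p)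
      ≤ (s ^ p) ^ (K - 2) * (t ^ p - s ^ p) ^ 2 / 8 :=
        midpointDefect_le hK hK1 (Real.rpow_pos_of_pos hs0 p) hmono
    _ ≤ (s ^ p) ^ (K - 2) * (s ^ (p - 1) * (t - s)) ^ 2 / 8 := by
        have : 0 ≤ t ^ p - s ^ p := sub_nonneg.2 hmono
        gcongr
    _ = (s ^ p) ^ (K - 2) * (s ^ (p - 1)) ^ 2 * ((t - s) ^ 2 / 8) := by ring
    _ ≤ s⁻¹ * ((t - s) ^ 2 / 8) := by gcongr
    _ = (t - s) ^ 2 / (8 * s) := by field_simp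


/-- Pointwise bound `|b(k,H,K)|/(4 - 4^{KH}) ≤ (22/(9 ln 4)) k^{-1}` for `k ≥ 2`. -/
theorem stmt_14 (K H : ℝ) (hK : K ∈ Set.Ioo (0 : ℝ) 1) (hH : H ∈ Set.Ioo (0 : ℝ) (1 / 2))
    (k : ℕ) (hk : 2 ≤ k) :
    |2 * (((k : ℝ) + 1) ^ (2 * H) + (k : ℝ) ^ (2 * H)) ^ K
      + 2 * ((k : ℝ) ^ (2 * H) + ((k : ℝ) - 1) ^ (2 * H)) ^ K
      - 2 ^ (K - 1) * (((k : ℝ) + 1) ^ (2 * K * H) + 4 * (k : ℝ) ^ (2 * K * H)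
          + ((k : ℝ) - 1) ^ (2 * K * H))
      - (((k : ℝ) + 1) ^ (2 * H) + ((k : ℝ) - 1) ^ (2 * H)) ^ K|
      / (4 - 4 ^ (K * H))
    ≤ (22 / (9 * Real.log 4)) * ((k : ℝ))⁻¹ := by
  obtain ⟨hK0, hK1⟩ := hK
  obtain ⟨hH0, hH1⟩ := hH
  have hk2 : (2 : ℝ) ≤ k := by exact_mod_cast hk
  generalize (k : ℝ) = x at hk2 ⊢
  have hp : 0 ≤ 2 * H := by linarith
  have hp1 : 2 * H ≤ 1 := by linarith
  have hpow (s : ℝ) (hs : 0 ≤ s) : s ^ (2 * K * H) = (s ^ (2 * H)) ^ K := by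
    rw [← Real.rpow_mul hs]; congr 1; ring
  rw [hpow _ (by linarith), hpow _ (by linarith), hpow _ (by linarith)]
  have hab := midpointDefect_rpow_le hK0.le hK1.le hp hp1
    (by linarith : 1 ≤ x) (by linarith : x ≤ x + 1)
  have hbc := midpointDefect_rpow_le hK0.le hK1.le hp hp1
    (by linarith : 1 ≤ x - 1) (by linarith : x - 1 ≤ x)
  have hac := midpointDefect_rpow_le hK0.le hK1.le hp hp1
    (by linarith : 1 ≤ x - 1) (by linarith : x - 1 ≤ x + 1)
  have ha : 0 < (x + 1) ^ (2 * H) := Real.rpow_pos_of_pos (by linarith) _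
  have hb : 0 < x ^ (2 * H) := Real.rpow_pos_of_pos (by linarith) _
  have hc : 0 < (x - 1) ^ (2 * H) := Real.rpow_pos_of_pos (by linarith) _
  have hab0 := midpointDefect_nonneg hK0.le hK1.le ha hb
  have hbc0 := midpointDefect_nonneg hK0.le hK1.le hb hc
  have hac0 := midpointDefect_nonneg hK0.le hK1.le ha hc
  have hx0 : 0 < x := by linarith
  have hinv : (8 * (x - 1))⁻¹ ≤ x⁻¹ / 4 := by
    rw [show x⁻¹ / 4 = (4 * x)⁻¹ by rw [mul_inv]; ring]
    exact inv_anti₀ (by positivity) (by linarith)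
  have hab' : (x + 1 - x) ^ 2 / (8 * x) = x⁻¹ / 8 := by field_simp; ring
  have hbc' : (x - (x - 1)) ^ 2 / (8 * (x - 1)) = (8 * (x - 1))⁻¹ := by
    rw [sub_sub_cancel]; simp
  have hac' : (x + 1 - (x - 1)) ^ 2 / (8 * (x - 1)) = 4 * (8 * (x - 1))⁻¹ := by
    rw [div_eq_mul_inv]; ring
  rw [hab'] at hab
  rw [hbc'] at hbc
  rw [hac'] at hac
  have hxi : 0 < x⁻¹ := inv_pos.2 hx0
  have hnum : |2 * midpointDefect K ((x + 1) ^ (2 * H)) (x ^ (2 * H))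
      + 2 * midpointDefect K (x ^ (2 * H)) ((x - 1) ^ (2 * H))
      - midpointDefect K ((x + 1) ^ (2 * H)) ((x - 1) ^ (2 * H))| ≤ x⁻¹ := by
    rw [abs_le]; constructor <;> linarith
  have hden : 2 ≤ 4 - (4 : ℝ) ^ (K * H) := by
    have h4 : (4 : ℝ) ^ (K * H) ≤ 4 ^ (1 / 2 : ℝ) :=
      Real.rpow_le_rpow_of_exponent_le (by norm_num) (by nlinarith)
    have h42 : (4 : ℝ) ^ (1 / 2 : ℝ) = 2 := by
      rw [← Real.sqrt_eq_rpow, show (4 : ℝ) = 2 ^ 2 by norm_num]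
      exact Real.sqrt_sq (by norm_num)
    linarith
  have hlog : 0 < Real.log 4 := Real.log_pos (by norm_num)
  have hlog3 : Real.log 4 ≤ 3 := by
    have := Real.log_le_sub_one_of_pos (by norm_num : (0 : ℝ) < 4)
    linarith
  have hconst : 1 / 2 ≤ 22 / (9 * Real.log 4) := by
    rw [div_le_div_iff₀ (by norm_num) (by positivity)]
    linarith
  calc _ = |2 * midpointDefect K ((x + 1) ^ (2 * H)) (x ^ (2 * H))
      + 2 * midpointDefect K (x ^ (2 * H)) ((x - 1) ^ (2 * H))
      - midpointDefect K ((x + 1) ^ (2 * H)) ((x - 1) ^ (2 * H))| / (4 - 4 ^ (K * H)) := by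
        congr 2
        simp only [midpointDefect]
        ring
    _ ≤ x⁻¹ / 2 := by gcongr
    _ = 1 / 2 * x⁻¹ := by ring
    _ ≤ _ := by gcongr
end

section
/- Let K in (0,1), H in (0,1/2), T > 0, n >= 2 an integer, grid t_i = i*T/n, and F_{KH}(t,s) := 2^{-K}((t^{2H} + s^{2H})^K - |t-s|^{2HK}). For 1 <= j, k <= n-1 define \hat d^{B^{KH},n}_{jk} := sum_{a=-1}^{1} sum_{b=-1}^{1} w_a w_b F_{KH}(t_{j+a}, t_{k+b}) (weights w_{-1} = w_1 = 1, w_0 = -2) and d^{B^{KH},n}_{jk} := (n^{2HK} / (2^{1-K} T^{2HK} (4 - 2^{2HK}))) * \hat d^{B^{KH},n}_{jk}. Then max_{1 <= k <= n-1} sum_{j=1}^{n-1} |d^{B^{KH},n}_{jk}| <= 5.005. -/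
open Set

/-- A nondecreasing concave function on `[0, ∞)` satisfies a one-sided midpoint inequality. -/
lemma ConcaveOn.add_le_two_mul_of_monotoneOn {f : ℝ → ℝ} (hf : ConcaveOn ℝ (Ici 0) f)
    (hm : MonotoneOn f (Ici 0)) {x y z : ℝ} (hx : 0 ≤ x) (hy : 0 ≤ y) (hz : x + y ≤ 2 * z) :
    f x + f y ≤ 2 * f z := by
  have h := hf.2 (mem_Ici.2 hx) (mem_Ici.2 hy) (by norm_num : (0 : ℝ) ≤ 1 / 2)
    (by norm_num : (0 : ℝ) ≤ 1 / 2) (by norm_num)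
  simp only [smul_eq_mul] at h
  have hmid : f (1 / 2 * x + 1 / 2 * y) ≤ f z :=
    hm (mem_Ici.2 (by linarith)) (mem_Ici.2 (by linarith)) (by linarith)
  linarith

lemma rpow_add_rpow_le_two_mul_rpow {p : ℝ} (hp : 0 ≤ p) (hp1 : p ≤ 1) {x y z : ℝ}
    (hx : 0 ≤ x) (hy : 0 ≤ y) (hz : x + y ≤ 2 * z) : x ^ p + y ^ p ≤ 2 * z ^ p :=
  (Real.concaveOn_rpow hp hp1).add_le_two_mul_of_monotoneOn
    (Real.monotoneOn_rpow_Ici_of_exponent_nonneg hp) hx hy hz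

lemma two_mul_rpow_le_rpow_add_rpow {p : ℝ} (hp : p ≤ 0) {x y z : ℝ}
    (hx : 0 < x) (hy : 0 < y) (hz : x + y ≤ 2 * z) : 2 * z ^ p ≤ x ^ p + y ^ p := by
  have hz0 : 0 < z := by linarith
  have hsq : ∀ r : ℝ, 0 < r → r ^ p = r ^ (p / 2) * r ^ (p / 2) := fun r hr ↦ by
    rw [← Real.rpow_add hr, add_halves]
  have hxy : x * y ≤ z * z := by nlinarith [sq_nonneg (x - y)]
  have h := Real.rpow_le_rpow_of_nonpos (mul_pos hx hy) hxy (show p / 2 ≤ 0 by linarith)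
  rw [Real.mul_rpow hx.le hy.le, Real.mul_rpow hz0.le hz0.le] at h
  rw [hsq x hx, hsq y hy, hsq z hz0]
  nlinarith [sq_nonneg (x ^ (p / 2) - y ^ (p / 2))]

/-- The second difference of `s ↦ (u + s) ^ p` over the nodes `c, b, a`. -/
noncomputable def rpowSecondDiff (p a b c u : ℝ) : ℝ :=
  (u + a) ^ p - 2 * (u + b) ^ p + (u + c) ^ p

section RpowSecondDiff

variable {p a b c : ℝ}

lemma rpowSecondDiff_nonpos (hp : 0 ≤ p) (hp1 : p ≤ 1) (ha : 0 ≤ a) (hc : 0 ≤ c)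
    (hb : a + c ≤ 2 * b) {u : ℝ} (hu : 0 ≤ u) : rpowSecondDiff p a b c u ≤ 0 := by
  have := rpow_add_rpow_le_two_mul_rpow hp hp1 (x := u + a) (y := u + c) (z := u + b)
    (by linarith) (by linarith) (by linarith)
  unfold rpowSecondDiff
  linarith

lemma rpowSecondDiff_nonneg (hp : p ≤ 0) (ha : 0 ≤ a) (hc : 0 ≤ c)
    (hb : a + c ≤ 2 * b) {u : ℝ} (hu : 0 < u) : 0 ≤ rpowSecondDiff p a b c u := by
  have := two_mul_rpow_le_rpow_add_rpow hp (x := u + a) (y := u + c) (z := u + b)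
    (by linarith) (by linarith) (by linarith)
  unfold rpowSecondDiff
  linarith

lemma continuous_rpowSecondDiff (hp : 0 ≤ p) : Continuous (rpowSecondDiff p a b c) := by
  have h : ∀ v : ℝ, Continuous fun u : ℝ ↦ (u + v) ^ p := fun v ↦
    (continuous_id.add continuous_const).rpow_const fun _ ↦ Or.inr hp
  exact ((h a).sub (continuous_const.mul (h b))).add (h c)

lemma hasDerivAt_rpowSecondDiff (p : ℝ) (ha : 0 ≤ a) (hb : 0 ≤ b) (hc : 0 ≤ c) {u : ℝ}
    (hu : 0 < u) :
    HasDerivAt (rpowSecondDiff p a b c) (p * rpowSecondDiff (p - 1) a b c u) u := by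
  have h : ∀ v : ℝ, 0 ≤ v →
      HasDerivAt (fun u : ℝ ↦ (u + v) ^ p) (1 * p * (u + v) ^ (p - 1)) u := fun v hv ↦
    ((hasDerivAt_id u).add_const v).rpow_const (Or.inl (by simp only [id]; linarith))
  refine (((h a ha).sub ((h b hb).const_mul 2)).add (h c hc)).congr_deriv ?_
  unfold rpowSecondDiff
  ring

lemma monotoneOn_rpowSecondDiff (hp : 0 ≤ p) (hp1 : p ≤ 1) (ha : 0 ≤ a) (hc : 0 ≤ c)
    (hb : a + c ≤ 2 * b) : MonotoneOn (rpowSecondDiff p a b c) (Ici 0) := by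
  refine monotoneOn_of_hasDerivWithinAt_nonneg (convex_Ici 0)
    (continuous_rpowSecondDiff hp).continuousOn
    (f' := fun u ↦ p * rpowSecondDiff (p - 1) a b c u) (fun u hu ↦ ?_) (fun u hu ↦ ?_) <;>
  rw [interior_Ici] at hu
  · exact (hasDerivAt_rpowSecondDiff p ha (by linarith) hc hu).hasDerivWithinAt
  · exact mul_nonneg hp (rpowSecondDiff_nonneg (by linarith) ha hc hb hu)

lemma concaveOn_rpowSecondDiff (hp : 0 ≤ p) (hp1 : p ≤ 1) (ha : 0 ≤ a) (hc : 0 ≤ c)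
    (hb : a + c ≤ 2 * b) : ConcaveOn ℝ (Ici 0) (rpowSecondDiff p a b c) := by
  refine concaveOn_of_hasDerivWithinAt2_nonpos (convex_Ici 0)
    (continuous_rpowSecondDiff hp).continuousOn
    (f' := fun u ↦ p * rpowSecondDiff (p - 1) a b c u)
    (f'' := fun u ↦ p * ((p - 1) * rpowSecondDiff (p - 1 - 1) a b c u))
    (fun u hu ↦ ?_) (fun u hu ↦ ?_) (fun u hu ↦ ?_) <;>
  rw [interior_Ici] at hu
  · exact (hasDerivAt_rpowSecondDiff p ha (by linarith) hc hu).hasDerivWithinAt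
  · exact ((hasDerivAt_rpowSecondDiff (p - 1) ha (by linarith) hc hu).const_mul p).hasDerivWithinAt
  · exact mul_nonpos_of_nonneg_of_nonpos hp (mul_nonpos_of_nonpos_of_nonneg (by linarith)
      (rpowSecondDiff_nonneg (by linarith) ha hc hb hu))

end RpowSecondDiff

/-- For a sequence with nonpositive second differences and nonnegative last increment, the
absolute second differences sum to at most the first increment. -/
lemma sum_abs_second_diff_le {g : ℕ → ℝ} (hconc : ∀ i, g (i + 2) - 2 * g (i + 1) + g i ≤ 0)
    (hmono : ∀ i, g i ≤ g (i + 1)) (N : ℕ) :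
    ∑ i ∈ Finset.range N, |g (i + 2) - 2 * g (i + 1) + g i| ≤ g 1 - g 0 := by
  have h : ∑ i ∈ Finset.range N, |g (i + 2) - 2 * g (i + 1) + g i| =
      g 1 - g 0 - (g (N + 1) - g N) := by
    induction N with
    | zero => simp
    | succ N ih => rw [Finset.sum_range_succ, ih, abs_of_nonpos (hconc N)]; ring
  linarith [hmono N]

lemma sum_Icc_one_eq_sum_range (f : ℤ → ℝ) (N : ℕ) :
    ∑ j ∈ Finset.Icc (1 : ℤ) N, f j = ∑ i ∈ Finset.range N, f (i + 1) := by
  induction N with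
  | zero => simp
  | succ N ih =>
    have : Finset.Icc (1 : ℤ) (N + 1 : ℕ) = insert ((N : ℤ) + 1) (Finset.Icc (1 : ℤ) N) := by
      ext x; simp only [Finset.mem_Icc, Finset.mem_insert]; push_cast; omega
    rw [Finset.sum_range_succ, ← ih, this, Finset.sum_insert (by simp), add_comm]

/-- The fourth difference of `|x| ^ β`. -/
noncomputable def absRpowFourthDiff (β x : ℝ) : ℝ :=
  |x + 2| ^ β - 4 * |x + 1| ^ β + 6 * |x| ^ β - 4 * |x - 1| ^ β + |x - 2| ^ β

lemma absRpowFourthDiff_neg (β x : ℝ) : absRpowFourthDiff β (-x) = absRpowFourthDiff β x := by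
  have h : ∀ y, |-x + y| = |x - y| := fun y ↦ by rw [← abs_neg]; ring_nf
  have h' : ∀ y, |-x - y| = |x + y| := fun y ↦ by rw [← abs_neg]; ring_nf
  simp only [absRpowFourthDiff, h, h', abs_neg]
  ring

section FourthDiff

variable {β : ℝ}

lemma sum_abs_absRpowFourthDiff_add_two_le (hβ : 0 < β) (hβ1 : β < 1) (N : ℕ) :
    ∑ i ∈ Finset.range N, |absRpowFourthDiff β (i + 2)| ≤ 3 ^ β - 3 * 2 ^ β + 3 := by
  have hconc := concaveOn_rpowSecondDiff (a := 2) (b := 1) (c := 0) hβ.le hβ1.le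
    (by norm_num) le_rfl (by norm_num)
  have hmono := monotoneOn_rpowSecondDiff (a := 2) (b := 1) (c := 0) hβ.le hβ1.le
    (by norm_num) le_rfl (by norm_num)
  have h := sum_abs_second_diff_le (g := fun i : ℕ ↦ rpowSecondDiff β 2 1 0 i)
    (fun i ↦ by
      have := hconc.add_le_two_mul_of_monotoneOn hmono (x := (i + 2 : ℕ)) (y := i)
        (z := (i + 1 : ℕ)) (by positivity) (by positivity) (by push_cast; linarith)
      linarith)
    (fun i ↦ hmono (mem_Ici.2 (by positivity)) (mem_Ici.2 (by positivity)) (by simp)) N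
  convert h using 1
  · refine Finset.sum_congr rfl fun i _ ↦ congrArg _ ?_
    have hi : (0 : ℝ) ≤ i := i.cast_nonneg
    rw [absRpowFourthDiff, abs_of_nonneg (by linarith), abs_of_nonneg (by linarith),
      abs_of_nonneg (by linarith), abs_of_nonneg (by linarith), abs_of_nonneg (by linarith)]
    simp only [rpowSecondDiff]
    push_cast
    ring_nf
  · norm_num [rpowSecondDiff, Real.zero_rpow hβ.ne']
    ring

lemma sum_abs_absRpowFourthDiff_le (hβ : 0 < β) (hβ1 : β < 1) (s : Finset ℤ) :
    ∑ m ∈ s, |absRpowFourthDiff β m| ≤ 2 * (14 - 8 * 2 ^ β + 2 * 3 ^ β) := by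
  obtain ⟨N, hN⟩ : ∃ N : ℕ, s ⊆ Finset.Icc (-(N + 1 : ℕ) : ℤ) (N + 1 : ℕ) := by
    refine ⟨∑ m ∈ s, m.natAbs, fun m hm ↦ ?_⟩
    have := Finset.single_le_sum (f := Int.natAbs) (fun _ _ ↦ Nat.zero_le _) hm
    rw [Finset.mem_Icc]
    omega
  refine (Finset.sum_le_sum_of_subset_of_nonneg hN fun _ _ _ ↦ abs_nonneg _).trans ?_
  have heven : Function.Even fun m : ℤ ↦ |absRpowFourthDiff β m| := fun m ↦ by
    simp only [Int.cast_neg, absRpowFourthDiff_neg]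
  rw [Finset.sum_Icc_of_even_eq_range heven, Finset.sum_range_succ', Finset.sum_range_succ']
  have htail := sum_abs_absRpowFourthDiff_add_two_le hβ hβ1 N
  have h2 : (2 : ℝ) ^ β ≤ 2 := by
    simpa using Real.rpow_le_rpow_of_exponent_le (x := 2) (by norm_num) hβ1.le
  have h23 : (2 : ℝ) ^ β ≤ 3 ^ β := Real.rpow_le_rpow (by norm_num) (by norm_num) hβ.le
  have h0 : |absRpowFourthDiff β 0| = 2 * (4 - 2 ^ β) := by
    rw [show absRpowFourthDiff β 0 = -(2 * (4 - 2 ^ β)) by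
      norm_num [absRpowFourthDiff, Real.zero_rpow hβ.ne']; ring, abs_neg,
      abs_of_nonneg (by linarith)]
  have h1 : |absRpowFourthDiff β 1| = 7 - 4 * 2 ^ β + 3 ^ β := by
    rw [show absRpowFourthDiff β 1 = 7 - 4 * 2 ^ β + 3 ^ β by
      norm_num [absRpowFourthDiff, Real.zero_rpow hβ.ne']; ring, abs_of_nonneg (by linarith)]
  have hshift : ∀ i : ℕ, (((i + 1 + 1 : ℕ) : ℤ) : ℝ) = (i : ℝ) + 2 := fun i ↦ by
    push_cast; ring
  simp only [hshift, nsmul_eq_mul]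
  norm_num [h0, h1]
  linarith

end FourthDiff

/-- The double second difference of `(x ^ a + y ^ a) ^ K` is absolutely summable in one variable,
with a bound independent of the other. -/
lemma sum_abs_rpowSecondDiff_rpow_le {K a : ℝ} (hK : 0 < K) (hK1 : K < 1) (ha : 0 < a)
    (ha1 : a < 1) {y : ℝ} (hy : 1 ≤ y) (N : ℕ) :
    let G := fun x : ℝ ↦ rpowSecondDiff K ((y + 1) ^ a) (y ^ a) ((y - 1) ^ a) (x ^ a)
    ∑ j ∈ Finset.Icc (1 : ℤ) N, |G (j + 1) - 2 * G j + G (j - 1)| ≤ 1 := by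
  intro G
  have hp : 0 ≤ (y + 1) ^ a := Real.rpow_nonneg (by linarith) _
  have hm : 0 ≤ (y - 1) ^ a := Real.rpow_nonneg (by linarith) _
  have hmid : (y + 1) ^ a + (y - 1) ^ a ≤ 2 * y ^ a :=
    rpow_add_rpow_le_two_mul_rpow ha.le ha1.le (by linarith) (by linarith) (by linarith)
  have hconc := concaveOn_rpowSecondDiff hK.le hK1.le hp hm hmid
  have hmono := monotoneOn_rpowSecondDiff hK.le hK1.le hp hm hmid
  have h := sum_abs_second_diff_le (g := fun i : ℕ ↦ G i)
    (fun i ↦ by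
      have := hconc.add_le_two_mul_of_monotoneOn hmono (x := ((i + 2 : ℕ) : ℝ) ^ a)
        (y := (i : ℝ) ^ a) (z := ((i + 1 : ℕ) : ℝ) ^ a) (by positivity) (by positivity)
        (rpow_add_rpow_le_two_mul_rpow ha.le ha1.le (by positivity) (by positivity)
          (by push_cast; linarith))
      simp only [G]
      linarith)
    (fun i ↦ hmono (mem_Ici.2 (by positivity)) (mem_Ici.2 (by positivity))
      (Real.rpow_le_rpow (by positivity) (by simp) ha.le)) N
  have hG1 : G 1 ≤ 0 :=
    rpowSecondDiff_nonpos hK.le hK1.le hp hm hmid (Real.rpow_nonneg zero_le_one _)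
  have haK : 0 ≤ a * K := by positivity
  have hG0 : -1 ≤ G 0 := by
    have h1 : y ^ (a * K) ≤ (y - 1) ^ (a * K) + 1 := by
      simpa using Real.rpow_add_le_add_rpow (a := y - 1) (b := 1) (by linarith) zero_le_one haK
        (by nlinarith)
    have h2 : y ^ (a * K) ≤ (y + 1) ^ (a * K) :=
      Real.rpow_le_rpow (by linarith) (by linarith) haK
    simp only [G, rpowSecondDiff, Real.zero_rpow ha.ne', zero_add]
    rw [← Real.rpow_mul (by linarith), ← Real.rpow_mul (by linarith),
      ← Real.rpow_mul (by linarith)]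
    linarith
  rw [sum_Icc_one_eq_sum_range]
  refine le_trans (le_of_eq (Finset.sum_congr rfl fun i _ ↦ ?_)) (h.trans ?_)
  · push_cast
    ring_nf
  · norm_num
    linarith


/-- Uniform bound `max_k ∑_j |d^{B^{KH},n}_{jk}| ≤ 5.005` for the normalized
covariances of the second-order increments of bifractional Brownian motion. -/
theorem stmt_15 (K H : ℝ) (hK : K ∈ Set.Ioo (0 : ℝ) 1) (hH : H ∈ Set.Ioo (0 : ℝ) (1 / 2))
    (T : ℝ) (hT : 0 < T) (n : ℕ) (hn : 2 ≤ n)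
    (t : ℤ → ℝ) (ht : ∀ i, t i = (i : ℝ) * T / n)
    (F : ℝ → ℝ → ℝ)
    (hF : ∀ u s, F u s = 2 ^ (-K) * ((u ^ (2 * H) + s ^ (2 * H)) ^ K - |u - s| ^ (2 * H * K)))
    (w : ℤ → ℝ) (hwm : w (-1) = 1) (hw0 : w 0 = -2) (hw1 : w 1 = 1)
    (dhat : ℤ → ℤ → ℝ)
    (hdhat : ∀ j k, dhat j k = ∑ a ∈ Finset.Icc (-1 : ℤ) 1, ∑ c ∈ Finset.Icc (-1 : ℤ) 1,
      w a * w c * F (t (j + a)) (t (k + c)))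
    (d : ℤ → ℤ → ℝ)
    (hd : ∀ j k, d j k = (n : ℝ) ^ (2 * H * K) /
      (2 ^ (1 - K) * T ^ (2 * H * K) * (4 - 2 ^ (2 * H * K))) * dhat j k) :
    ∀ k : ℤ, 1 ≤ k → k ≤ (n : ℤ) - 1 →
      ∑ j ∈ Finset.Icc (1 : ℤ) ((n : ℤ) - 1), |d j k| ≤ 5.005 := by
  obtain ⟨hK0, hK1⟩ := hK
  obtain ⟨hH0, hH1⟩ := hH
  intro k hk hkn
  obtain ⟨N, rfl⟩ : ∃ N : ℕ, n = N + 1 := ⟨n - 1, by omega⟩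
  have hβ0 : 0 < 2 * H * K := by positivity
  have hβ1 : 2 * H * K < 1 := by nlinarith
  have h2 : (2 : ℝ) ^ (2 * H * K) ≤ 2 := by
    simpa using Real.rpow_le_rpow_of_exponent_le (x := 2) (by norm_num) hβ1.le
  have h2' : 1 ≤ (2 : ℝ) ^ (2 * H * K) := Real.one_le_rpow (by norm_num) hβ0.le
  have h3 : (3 : ℝ) ^ (2 * H * K) ≤ 2 ^ (2 * H * K) * 2 ^ (2 * H * K) := by
    rw [← Real.mul_rpow (by norm_num) (by norm_num)]
    exact Real.rpow_le_rpow (by norm_num) (by norm_num) hβ0.le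
  have hn0 : (0 : ℝ) < (N + 1 : ℕ) := by positivity
  have hscale : 0 < T / (N + 1 : ℕ) := by positivity
  have hFt : ∀ i l : ℤ, 0 ≤ i → 0 ≤ l → F (t i) (t l) =
      2 ^ (-K) * (T / (N + 1 : ℕ)) ^ (2 * H * K) *
        (((i : ℝ) ^ (2 * H) + (l : ℝ) ^ (2 * H)) ^ K - |(i : ℝ) - l| ^ (2 * H * K)) := by
    intro i l hi hl
    have hi' : (0 : ℝ) ≤ i := by exact_mod_cast hi
    have hl' : (0 : ℝ) ≤ l := by exact_mod_cast hl
    rw [hF, ht, ht, mul_div_assoc, mul_div_assoc, ← sub_mul, abs_mul, abs_of_pos hscale,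
      Real.mul_rpow hi' hscale.le, Real.mul_rpow hl' hscale.le,
      Real.mul_rpow (abs_nonneg _) hscale.le, ← add_mul,
      Real.mul_rpow (by positivity) (by positivity), ← Real.rpow_mul hscale.le]
    ring
  set G := fun x : ℝ ↦ rpowSecondDiff K (((k : ℝ) + 1) ^ (2 * H)) ((k : ℝ) ^ (2 * H))
    (((k : ℝ) - 1) ^ (2 * H)) (x ^ (2 * H)) with hG
  have hd' : ∀ j : ℤ, 1 ≤ j → d j k = ((G (j + 1) - 2 * G j + G (j - 1)) -
      absRpowFourthDiff (2 * H * K) (j - k : ℤ)) / (2 * (4 - 2 ^ (2 * H * K))) := by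
    intro j hj
    have hI : Finset.Icc (-1 : ℤ) 1 = {-1, 0, 1} := by decide
    have hcoef : ((N + 1 : ℕ) : ℝ) ^ (2 * H * K) /
        (2 ^ (1 - K) * T ^ (2 * H * K) * (4 - 2 ^ (2 * H * K))) *
        (2 ^ (-K) * (T / (N + 1 : ℕ)) ^ (2 * H * K)) = 1 / (2 * (4 - 2 ^ (2 * H * K))) := by
      have hne : (4 : ℝ) - 2 ^ (2 * H * K) ≠ 0 := by linarith
      rw [Real.div_rpow hT.le hn0.le, sub_eq_add_neg, Real.rpow_add two_pos, Real.rpow_one]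
      field_simp
    have hdh : dhat j k = 2 ^ (-K) * (T / (N + 1 : ℕ)) ^ (2 * H * K) *
        ((G (j + 1) - 2 * G j + G (j - 1)) - absRpowFourthDiff (2 * H * K) (j - k : ℤ)) := by
      rw [hdhat, hI]
      simp only [Finset.sum_insert, Finset.sum_singleton, Finset.mem_insert,
        Finset.mem_singleton, hwm, hw0, hw1, reduceCtorEq, or_self, not_false_eq_true,
        show ¬ ((0 : ℤ) = 1) by decide]
      rw [hFt _ _ (by omega) (by omega), hFt _ _ (by omega) (by omega),
        hFt _ _ (by omega) (by omega), hFt _ _ (by omega) (by omega),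
        hFt _ _ (by omega) (by omega), hFt _ _ (by omega) (by omega),
        hFt _ _ (by omega) (by omega), hFt _ _ (by omega) (by omega),
        hFt _ _ (by omega) (by omega)]
      simp only [hG, rpowSecondDiff, absRpowFourthDiff]
      push_cast
      ring_nf
    rw [hd, hdh, ← mul_assoc, hcoef]
    ring
  have hden : 0 < 2 * (4 - (2 : ℝ) ^ (2 * H * K)) := by linarith
  have hA := sum_abs_rpowSecondDiff_rpow_le hK0 hK1 (a := 2 * H) (by linarith) (by linarith)
    (y := k) (by exact_mod_cast hk) N
  have hB : ∑ j ∈ Finset.Icc (1 : ℤ) N, |absRpowFourthDiff (2 * H * K) (j - k : ℤ)| ≤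
      2 * (14 - 8 * 2 ^ (2 * H * K) + 2 * 3 ^ (2 * H * K)) := by
    have := sum_abs_absRpowFourthDiff_le hβ0 hβ1 ((Finset.Icc (1 : ℤ) N).image (· - k))
    rwa [Finset.sum_image (fun _ _ _ _ h ↦ sub_left_injective h)] at this
  have hN : (((N + 1 : ℕ) : ℤ) - 1) = N := by push_cast; ring
  rw [hN]
  calc ∑ j ∈ Finset.Icc (1 : ℤ) N, |d j k|
      ≤ ∑ j ∈ Finset.Icc (1 : ℤ) N, (|G (j + 1) - 2 * G j + G (j - 1)| +
          |absRpowFourthDiff (2 * H * K) (j - k : ℤ)|) / (2 * (4 - 2 ^ (2 * H * K))) := by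
        refine Finset.sum_le_sum fun j hj ↦ ?_
        rw [hd' j (Finset.mem_Icc.1 hj).1, abs_div, abs_of_pos hden]
        gcongr
        exact abs_sub _ _
    _ ≤ 5.005 := by
        rw [← Finset.sum_div, Finset.sum_add_distrib, div_le_iff₀ hden]
        have h := add_le_add hA hB
        refine h.trans ?_
        norm_num
        nlinarith
end

section
/- Let H in (0,1), K in (0,1], and F_{KH}(t,s) := 2^{-K}((t^{2H} + s^{2H})^K - |t-s|^{2HK}). For all s, t > 0 with s != t, the fourth order mixed partial derivative satisfies d^4 F_{KH} / (ds^2 dt^2)(s,t) = -\hat C^{(1)}_{KH} * |s-t|^{-(4-2KH)} + \hat C^{(2)}_{KH} * (s t)^{4H-2} (s^{2H} + t^{2H})^{K-4} + \hat C^{(3)}_{KH} * (s t)^{2H-2} (s^{2H} + t^{2H})^{K-2}, where \hat C^{(1)}_{KH} := 2HK(2KH-1)(2HK-2)(2HK-3) 2^{-K}, \hat C^{(2)}_{KH} := K(K-1)(K-2)(K-3)(2H)^4 2^{-K}, and \hat C^{(3)}_{KH} := K(K-1)(2H)^2 (2H-1) 2^{-K} (2KH - 2H - 1). -/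
open Filter Topology

theorem deriv_deriv_eq_of_eventually_hasDerivAt {f f' : ℝ → ℝ} {f'' x : ℝ}
    (hf : ∀ᶠ y in 𝓝 x, HasDerivAt f (f' y) y) (hf' : HasDerivAt f' f'' x) :
    deriv (deriv f) x = f'' :=
  (hf'.congr_of_eventuallyEq (hf.mono fun _ hy => hy.deriv)).deriv

theorem hasDerivAt_rpow_add_const_rpow (a p : ℝ) {v x : ℝ} (hv : 0 < v) (hx : 0 < x) :
    HasDerivAt (fun y : ℝ => (y ^ a + v) ^ p)
      (p * a * (x ^ (a - 1) * (x ^ a + v) ^ (p - 1))) x := by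
  have hw : x ^ a + v ≠ 0 := by positivity
  convert ((Real.hasDerivAt_rpow_const (p := a) (Or.inl hx.ne')).add_const v).rpow_const
    (p := p) (Or.inl hw) using 1
  ring

theorem hasDerivAt_rpow_mul_rpow_add_const_rpow (a p : ℝ) {v x : ℝ} (hv : 0 < v) (hx : 0 < x) :
    HasDerivAt (fun y : ℝ => p * a * (y ^ (a - 1) * (y ^ a + v) ^ (p - 1)))
      (p * a * (a - 1) * x ^ (a - 2) * (x ^ a + v) ^ (p - 1)
        + p * (p - 1) * a ^ 2 * x ^ (2 * a - 2) * (x ^ a + v) ^ (p - 2)) x := by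
  refine (((Real.hasDerivAt_rpow_const (p := a - 1) (Or.inl hx.ne')).mul
    (hasDerivAt_rpow_add_const_rpow a (p - 1) hv hx)).const_mul (p * a)).congr_deriv ?_
  have h : x ^ (2 * a - 2) = x ^ (a - 1) * x ^ (a - 1) := by
    rw [← Real.rpow_add hx]; congr 1; ring
  rw [h, show a - 1 - 1 = a - 2 by ring, show p - 1 - 1 = p - 2 by ring]
  ring

theorem hasDerivAt_abs_sub_rpow (r : ℝ) {c x : ℝ} (hx : x ≠ c) :
    HasDerivAt (fun y : ℝ => |y - c| ^ r) (r * (|x - c| ^ (r - 2) * (x - c))) x := by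
  have h0 : x - c ≠ 0 := sub_ne_zero.mpr hx
  have hpos : 0 < |x - c| := abs_pos.mpr h0
  refine (((hasDerivAt_abs h0).comp_sub_const x c).rpow_const (p := r)
    (Or.inl hpos.ne')).congr_deriv ?_
  have h : |x - c| ^ (r - 1) = |x - c| ^ (r - 2) * |x - c| := by
    rw [← Real.rpow_add_one hpos.ne']; congr 1; ring
  have hsign : |x - c| * SignType.sign (x - c) = x - c := abs_mul_sign _
  rw [h]
  linear_combination (r * |x - c| ^ (r - 2)) * hsign

theorem hasDerivAt_abs_sub_rpow_mul_sub (r : ℝ) {c x : ℝ} (hx : x ≠ c) :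
    HasDerivAt (fun y : ℝ => r * (|y - c| ^ (r - 2) * (y - c)))
      (r * (r - 1) * |x - c| ^ (r - 2)) x := by
  have hpos : 0 < |x - c| := abs_pos.mpr (sub_ne_zero.mpr hx)
  refine (((hasDerivAt_abs_sub_rpow (r - 2) hx).mul
    ((hasDerivAt_id x).sub_const c)).const_mul r).congr_deriv ?_
  have h : |x - c| ^ (r - 2) = |x - c| ^ (r - 2 - 2) * (x - c) ^ 2 := by
    rw [← sq_abs, ← Real.rpow_add_natCast hpos.ne']; congr 1; push_cast; ring
  simp only [id_eq]
  linear_combination (-(r * (r - 2))) * h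

/-- The second derivative of `y ↦ A (y ^ a + v) ^ p + B (y ^ a + v) ^ q + C |y - c| ^ r`. -/
theorem deriv_deriv_rpow_add_const_rpow_add_abs_sub_rpow (A B C a p q r : ℝ) {v c x : ℝ}
    (hv : 0 < v) (hx : 0 < x) (hxc : x ≠ c) :
    deriv (deriv fun y : ℝ => A * (y ^ a + v) ^ p + B * (y ^ a + v) ^ q + C * |y - c| ^ r) x
      = A * (p * a * (a - 1) * x ^ (a - 2) * (x ^ a + v) ^ (p - 1)
          + p * (p - 1) * a ^ 2 * x ^ (2 * a - 2) * (x ^ a + v) ^ (p - 2))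
        + B * (q * a * (a - 1) * x ^ (a - 2) * (x ^ a + v) ^ (q - 1)
          + q * (q - 1) * a ^ 2 * x ^ (2 * a - 2) * (x ^ a + v) ^ (q - 2))
        + C * (r * (r - 1) * |x - c| ^ (r - 2)) := by
  refine deriv_deriv_eq_of_eventually_hasDerivAt ?_
    ((((hasDerivAt_rpow_mul_rpow_add_const_rpow a p hv hx).const_mul A).add
      ((hasDerivAt_rpow_mul_rpow_add_const_rpow a q hv hx).const_mul B)).add
      ((hasDerivAt_abs_sub_rpow_mul_sub r hxc).const_mul C))
  filter_upwards [eventually_gt_nhds hx, eventually_ne_nhds hxc] with y hy hyc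
  exact (((hasDerivAt_rpow_add_const_rpow a p hv hy).const_mul A).add
    ((hasDerivAt_rpow_add_const_rpow a q hv hy).const_mul B)).add
    ((hasDerivAt_abs_sub_rpow r hyc).const_mul C)


/-- Fourth order mixed partial derivative of the bifractional Brownian motion
covariance function. -/
theorem stmt_16 (H K : ℝ) (hH : H ∈ Set.Ioo (0 : ℝ) 1) (hK : K ∈ Set.Ioc (0 : ℝ) 1)
    (F : ℝ → ℝ → ℝ)
    (hF : ∀ u s, F u s = 2 ^ (-K) * ((u ^ (2 * H) + s ^ (2 * H)) ^ K - |u - s| ^ (2 * H * K)))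
    (C1 C2 C3 : ℝ)
    (hC1 : C1 = 2 * H * K * (2 * K * H - 1) * (2 * H * K - 2) * (2 * H * K - 3) * 2 ^ (-K))
    (hC2 : C2 = K * (K - 1) * (K - 2) * (K - 3) * (2 * H) ^ 4 * 2 ^ (-K))
    (hC3 : C3 = K * (K - 1) * (2 * H) ^ 2 * (2 * H - 1) * 2 ^ (-K) * (2 * K * H - 2 * H - 1))
    (s t : ℝ) (hs : 0 < s) (ht : 0 < t) (hst : s ≠ t) :
    deriv (deriv (fun s' => deriv (deriv (fun t' => F t' s')) t)) s
      = -C1 * |s - t| ^ (-(4 - 2 * K * H))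
        + C2 * (s * t) ^ (4 * H - 2) * (s ^ (2 * H) + t ^ (2 * H)) ^ (K - 4)
        + C3 * (s * t) ^ (2 * H - 2) * (s ^ (2 * H) + t ^ (2 * H)) ^ (K - 2) := by
  have inner : ∀ y : ℝ, 0 < y → y ≠ t → deriv (deriv (fun t' => F t' y)) t
      = 2 ^ (-K) * (K * (2 * H) * (2 * H - 1) * t ^ (2 * H - 2))
          * (y ^ (2 * H) + t ^ (2 * H)) ^ (K - 1)
        + 2 ^ (-K) * (K * (K - 1) * (2 * H) ^ 2 * t ^ (2 * (2 * H) - 2))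
          * (y ^ (2 * H) + t ^ (2 * H)) ^ (K - 2)
        + -2 ^ (-K) * (2 * H * K * (2 * H * K - 1)) * |y - t| ^ (2 * H * K - 2) := by
    intro y hy hyt
    have hFy : (fun t' => F t' y) = fun t' : ℝ =>
        2 ^ (-K) * (t' ^ (2 * H) + y ^ (2 * H)) ^ K + 0 * (t' ^ (2 * H) + y ^ (2 * H)) ^ K
          + -2 ^ (-K) * |t' - y| ^ (2 * H * K) := by
      funext t'
      rw [hF]
      ring
    rw [hFy, deriv_deriv_rpow_add_const_rpow_add_abs_sub_rpow _ _ _ _ _ _ _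
      (Real.rpow_pos_of_pos hy _) ht hyt.symm, abs_sub_comm t y, add_comm (t ^ (2 * H))]
    ring
  have outer : (fun s' => deriv (deriv (fun t' => F t' s')) t) =ᶠ[𝓝 s] fun y : ℝ =>
      2 ^ (-K) * (K * (2 * H) * (2 * H - 1) * t ^ (2 * H - 2))
          * (y ^ (2 * H) + t ^ (2 * H)) ^ (K - 1)
        + 2 ^ (-K) * (K * (K - 1) * (2 * H) ^ 2 * t ^ (2 * (2 * H) - 2))
          * (y ^ (2 * H) + t ^ (2 * H)) ^ (K - 2)
        + -2 ^ (-K) * (2 * H * K * (2 * H * K - 1)) * |y - t| ^ (2 * H * K - 2) := by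
    filter_upwards [eventually_gt_nhds hs, eventually_ne_nhds hst] with y hy hyt
    exact inner y hy hyt
  rw [outer.deriv.deriv_eq, deriv_deriv_rpow_add_const_rpow_add_abs_sub_rpow _ _ _ _ _ _ _
    (Real.rpow_pos_of_pos ht _) hs hst]
  have hw : 0 < s ^ (2 * H) + t ^ (2 * H) := by positivity
  have hpow : ∀ x : ℝ, 0 < x → x ^ (2 * (2 * H) - 2) = x ^ (2 * H - 2) * x ^ (2 * H) := by
    intro x hx
    rw [← Real.rpow_add hx]
    congr 1
    ring
  have hwK : (s ^ (2 * H) + t ^ (2 * H)) ^ (K - 2)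
      = (s ^ (2 * H) + t ^ (2 * H)) ^ (K - 3) * (s ^ (2 * H) + t ^ (2 * H)) := by
    rw [← Real.rpow_add_one hw.ne']
    congr 1
    ring
  rw [Real.mul_rpow hs.le ht.le, Real.mul_rpow hs.le ht.le,
    show -(4 - 2 * K * H) = 2 * H * K - 2 - 2 by ring,
    show 4 * H - 2 = 2 * (2 * H) - 2 by ring, show K - 1 - 1 = K - 2 by ring,
    show K - 1 - 2 = K - 3 by ring, show K - 2 - 1 = K - 3 by ring,
    show K - 2 - 2 = K - 4 by ring, hpow s hs, hpow t ht, hwK, hC1, hC2, hC3]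
  ring
end

section
/- Let H in (0,1). Define \hat rho_{KH}(r) := 6 r^{KH+2} - 4(r-1)^{KH+2} - 4(r+1)^{KH+2} + (r-2)^{KH+2} + (r+2)^{KH+2} for integers r >= 2, where KH denotes a parameter gamma = KH in (0,1). Then the series sum_{j=2}^{infinity} |\hat rho_{gamma}(j)| converges and equals 3 - 3 * 2^{gamma+2} + 3^{gamma+2}. -/
open Set Filter Topology

theorem hasDerivAt_fwdDiff_iter_s19 {g h : ℝ → ℝ} {x : ℝ} (hg : ∀ y, x < y → HasDerivAt g (h y) y)
    (k : ℕ) : ∀ y, x < y → HasDerivAt ((fwdDiff 1)^[k] g) ((fwdDiff 1)^[k] h y) y := by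
  induction k with
  | zero => simpa using hg
  | succ k ih =>
    intro y hy
    rw [Function.iterate_succ_apply', Function.iterate_succ_apply']
    exact ((ih (y + 1) (by linarith)).comp_add_const y 1).sub (ih y hy)

theorem continuousOn_fwdDiff_iter {g : ℝ → ℝ} {x : ℝ} (hg : ContinuousOn g (Ici x)) (k : ℕ) :
    ContinuousOn ((fwdDiff 1)^[k] g) (Ici x) := by
  induction k with
  | zero => simpa using hg
  | succ k ih =>
    rw [Function.iterate_succ_apply']
    refine (ih.comp (by fun_prop) fun y hy => ?_).sub ih
    simp only [mem_Ici] at hy ⊢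
    linarith

theorem exists_fwdDiff_iter_succ_eq {g h : ℝ → ℝ} {x : ℝ} (hc : ContinuousOn g (Ici x))
    (hg : ∀ y, x < y → HasDerivAt g (h y) y) (k : ℕ) :
    ∃ ξ, x < ξ ∧ (fwdDiff 1)^[k + 1] g x = (fwdDiff 1)^[k] h ξ := by
  obtain ⟨ξ, hξ, h⟩ := exists_hasDerivAt_eq_slope ((fwdDiff 1)^[k] g) ((fwdDiff 1)^[k] h)
    (lt_add_one x) ((continuousOn_fwdDiff_iter hc k).mono Icc_subset_Ici_self)
    fun y hy => hasDerivAt_fwdDiff_iter_s19 hg k y hy.1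
  refine ⟨ξ, hξ.1, ?_⟩
  rw [h, Function.iterate_succ_apply', fwdDiff]
  simp

theorem exists_fwdDiff_iter_succ_rpow_eq {a x : ℝ} (hx : 0 ≤ x) (ha : 0 < a ∨ 0 < x) (k : ℕ) :
    ∃ ξ, x < ξ ∧ (fwdDiff 1)^[k + 1] (fun y : ℝ => y ^ a) x =
      a * (fwdDiff 1)^[k] (fun y : ℝ => y ^ (a - 1)) ξ := by
  obtain ⟨ξ, hξ, h⟩ := exists_fwdDiff_iter_succ_eq (g := fun y : ℝ => y ^ a)
    (h := a • fun y : ℝ => y ^ (a - 1)) (x := x)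
    (fun y hy => (Real.continuousAt_rpow_const y a
      (ha.elim (fun h => Or.inr h.le)
        fun h => Or.inl (h.trans_le hy).ne')).continuousWithinAt)
    (fun y hy => Real.hasDerivAt_rpow_const (Or.inl (hx.trans_lt hy).ne')) k
  refine ⟨ξ, hξ, ?_⟩
  rw [h, fwdDiff_iter_const_smul]
  rfl

theorem exists_fwdDiff_iter_three_rpow_eq {γ x : ℝ} (hγ : 0 < γ) (hx : 0 ≤ x) :
    ∃ ξ, x < ξ ∧ (fwdDiff 1)^[3] (fun y : ℝ => y ^ (γ + 2)) x =
      (γ + 2) * ((γ + 1) * (γ * ξ ^ (γ - 1))) := by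
  obtain ⟨u, hu, h₁⟩ := exists_fwdDiff_iter_succ_rpow_eq (a := γ + 2) hx (.inl (by linarith)) 2
  obtain ⟨v, hv, h₂⟩ := exists_fwdDiff_iter_succ_rpow_eq (a := γ + 1) (hx.trans hu.le)
    (.inl (by linarith)) 1
  obtain ⟨w, hw, h₃⟩ := exists_fwdDiff_iter_succ_rpow_eq (a := γ) (hx.trans (hu.trans hv).le)
    (.inl hγ) 0
  refine ⟨w, hu.trans (hv.trans hw), ?_⟩
  rw [h₁, show γ + 2 - 1 = γ + 1 by ring, h₂, show γ + 1 - 1 = γ by ring, h₃]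
  rfl

theorem fwdDiff_iter_four_rpow_nonpos {γ x : ℝ} (hγ : γ ∈ Ioo (0 : ℝ) 1) (hx : 0 ≤ x) :
    (fwdDiff 1)^[4] (fun y : ℝ => y ^ (γ + 2)) x ≤ 0 := by
  obtain ⟨h0, h1⟩ := hγ
  obtain ⟨u, hu, h₁⟩ := exists_fwdDiff_iter_succ_rpow_eq (a := γ + 2) hx (.inl (by linarith)) 3
  obtain ⟨v, hv, h₂⟩ := exists_fwdDiff_iter_succ_rpow_eq (a := γ + 1) (hx.trans hu.le)
    (.inl (by linarith)) 2
  obtain ⟨w, hw, h₃⟩ := exists_fwdDiff_iter_succ_rpow_eq (a := γ) (hx.trans (hu.trans hv).le)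
    (.inl h0) 1
  have hw0 : 0 < w := hx.trans_lt (hu.trans (hv.trans hw))
  obtain ⟨z, hz, h₄⟩ := exists_fwdDiff_iter_succ_rpow_eq (a := γ - 1) hw0.le (.inr hw0) 0
  rw [h₁, show γ + 2 - 1 = γ + 1 by ring, h₂, show γ + 1 - 1 = γ by ring, h₃, h₄]
  have hz0 : 0 ≤ z ^ (γ - 1 - 1) := Real.rpow_nonneg (hw0.trans hz).le _
  have h : (γ - 1) * z ^ (γ - 1 - 1) ≤ 0 :=
    mul_nonpos_of_nonpos_of_nonneg (by linarith) hz0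
  exact mul_nonpos_of_nonneg_of_nonpos (by linarith)
    (mul_nonpos_of_nonneg_of_nonpos (by linarith) (mul_nonpos_of_nonneg_of_nonpos h0.le h))

theorem tendsto_fwdDiff_iter_three_rpow {γ : ℝ} (hγ : γ ∈ Ioo (0 : ℝ) 1) :
    Tendsto ((fwdDiff 1)^[3] (fun y : ℝ => y ^ (γ + 2))) atTop (𝓝 0) := by
  obtain ⟨h0, h1⟩ := hγ
  have hlim : Tendsto (fun x : ℝ => (γ + 2) * ((γ + 1) * (γ * x ^ (γ - 1)))) atTop (𝓝 0) := by
    have h := tendsto_rpow_neg_atTop (y := 1 - γ) (by linarith)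
    rw [neg_sub] at h
    simpa using ((h.const_mul γ).const_mul (γ + 1)).const_mul (γ + 2)
  refine tendsto_of_tendsto_of_tendsto_of_le_of_le' tendsto_const_nhds hlim ?_ ?_ <;>
    filter_upwards [eventually_gt_atTop 0] with x hx <;>
    obtain ⟨ξ, hξ, h⟩ := exists_fwdDiff_iter_three_rpow_eq h0 hx.le <;> rw [h]
  · have := hx.trans hξ
    positivity
  · have := Real.rpow_le_rpow_of_nonpos hx hξ.le (by linarith : γ - 1 ≤ 0)
    gcongr

/-- The series `∑_{j=2}^∞ |ρ̂_γ(j)|` converges to `3 - 3·2^{γ+2} + 3^{γ+2}`. -/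
theorem stmt_19 (γ : ℝ) (hγ : γ ∈ Set.Ioo (0 : ℝ) 1)
    (ρhat : ℤ → ℝ)
    (hρ : ∀ r : ℤ, 2 ≤ r → ρhat r =
      6 * (r : ℝ) ^ (γ + 2) - 4 * ((r : ℝ) - 1) ^ (γ + 2) - 4 * ((r : ℝ) + 1) ^ (γ + 2)
      + ((r : ℝ) - 2) ^ (γ + 2) + ((r : ℝ) + 2) ^ (γ + 2)) :
    HasSum (fun j : ℕ => |ρhat ((j : ℤ) + 2)|)
      (3 - 3 * 2 ^ (γ + 2) + 3 ^ (γ + 2)) := by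
  set D := (fwdDiff (1 : ℝ))^[3] (fun y : ℝ => y ^ (γ + 2)) with hD
  have hρD (j : ℕ) : |ρhat ((j : ℤ) + 2)| = D j - D ((j + 1 : ℕ) : ℝ) := by
    have h4 : ρhat ((j : ℤ) + 2) = (fwdDiff 1)^[4] (fun y : ℝ => y ^ (γ + 2)) j := by
      rw [hρ _ (by omega)]
      simp only [Function.iterate_succ, Function.iterate_zero, Function.comp_apply, id, fwdDiff]
      push_cast
      ring_nf
    rw [h4, abs_of_nonpos (fwdDiff_iter_four_rpow_nonpos hγ j.cast_nonneg),
      Function.iterate_succ_apply', ← hD, fwdDiff]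
    push_cast
    ring
  have hD0 : D ((0 : ℕ) : ℝ) = 3 - 3 * 2 ^ (γ + 2) + 3 ^ (γ + 2) := by
    have h : (0 : ℝ) ^ (γ + 2) = 0 := Real.zero_rpow (by linarith [hγ.1])
    simp only [hD, Function.iterate_succ, Function.iterate_zero, Function.comp_apply, id, fwdDiff]
    norm_num [h]
    ring
  rw [hasSum_iff_tendsto_nat_of_nonneg fun _ => abs_nonneg _]
  simp_rw [hρD, Finset.sum_range_sub' (fun n : ℕ => D n), hD0]
  have hlim : Tendsto D atTop (𝓝 0) := tendsto_fwdDiff_iter_three_rpow hγ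
  simpa only [sub_zero, Function.comp_apply] using (hlim.comp tendsto_natCast_atTop_atTop).const_sub
    (3 - 3 * 2 ^ (γ + 2) + 3 ^ (γ + 2))
end
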